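/- arXiv:1703.10512 — 6 statements merged into one kernel-verified Lean document; each statement's English description precedes it below -/
import Mathlib

section
/- Let (a,b,c,d,e,f,μ) ∈ ℝ⁷ with a,b,c,d,e,f > 0 be a solution of the system (S0). Then a = b = c = d = e = f = 1 and μ = −1. In particular, (S0) has exactly one solution with positive a,…,f, namely the one corresponding to the standard (bi-invariant) Einstein metric on S³×S³. -/
/-- The system (S0) of 7 polynomial equations arising from left-invariant Einstein
metrics on S³×S³ invariant under an inner involution of trace 2. -/
def SystemS0 (a b c d e f μ : ℝ) : Prop :=
  a*b*c*d*e*f - 1 = 0 ∧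
  a*b*c*μ + a^4*b^4*d*e*f - a^4*c^4*d*e*f - b^4*c^4*d*e*f + 2*a^2*b^2*c^4*d*e*f = 0 ∧
  a*b*c*μ - a^4*b^4*d*e*f + a^4*c^4*d*e*f - b^4*c^4*d*e*f + 2*a^2*b^4*c^2*d*e*f = 0 ∧
  a*b*c*μ - a^4*b^4*d*e*f - a^4*c^4*d*e*f + b^4*c^4*d*e*f + 2*a^4*b^2*c^2*d*e*f = 0 ∧
  d*e*f*μ + a*b*c*d^4*e^4 - a*b*c*d^4*f^4 - a*b*c*e^4*f^4 + 2*a*b*c*d^2*e^2*f^4 = 0 ∧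
  d*e*f*μ - a*b*c*d^4*e^4 + a*b*c*d^4*f^4 - a*b*c*e^4*f^4 + 2*a*b*c*d^2*e^4*f^2 = 0 ∧
  d*e*f*μ - a*b*c*d^4*e^4 - a*b*c*d^4*f^4 + a*b*c*e^4*f^4 + 2*a*b*c*d^4*e^2*f^2 = 0

/-- If `(y - z)² - x²` is unchanged by cyclic permutations of `x, y, z`, with `x` and `y`
positive, then `x = y`. -/
lemma eq_of_cyclic_sq_sub {x y z M : ℝ} (hx : 0 < x) (hy : 0 < y)
    (h₁ : M + x ^ 2 - (y - z) ^ 2 = 0) (h₂ : M + y ^ 2 - (x - z) ^ 2 = 0)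
    (h₃ : M + z ^ 2 - (x - y) ^ 2 = 0) : x = y := by
  have h : (x - y) * (x + y - z) = 0 := by linear_combination (h₁ - h₂) / 2
  rcases mul_eq_zero.mp h with h | h
  · linarith
  · obtain rfl : z = x + y := by linarith
    have := mul_pos hx hy
    nlinarith

/-- One half of the system, with `p = d * e * f`, forces its three variables to coincide
and determines `μ`. -/
lemma eq_of_half_system {a b c p μ : ℝ} (ha : 0 < a) (hb : 0 < b) (hc : 0 < c) (hp : 0 < p)
    (h₁ : a * b * c * μ + p * ((a * b) ^ 4 - (a * c) ^ 4 - (b * c) ^ 4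
      + 2 * (a * c) ^ 2 * (b * c) ^ 2) = 0)
    (h₂ : a * b * c * μ + p * ((a * c) ^ 4 - (a * b) ^ 4 - (b * c) ^ 4
      + 2 * (a * b) ^ 2 * (b * c) ^ 2) = 0)
    (h₃ : a * b * c * μ + p * ((b * c) ^ 4 - (a * b) ^ 4 - (a * c) ^ 4
      + 2 * (a * b) ^ 2 * (a * c) ^ 2) = 0) :
    b = a ∧ c = a ∧ μ = -(p * a ^ 5) := by
  obtain ⟨M, hM⟩ : ∃ M, a * b * c * μ = p * M := ⟨a * b * c * μ / p, by field_simp⟩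
  rw [hM] at h₁ h₂ h₃
  have k₁ : M + ((a * b) ^ 2) ^ 2 - ((a * c) ^ 2 - (b * c) ^ 2) ^ 2 = 0 :=
    mul_left_cancel₀ hp.ne' (by linear_combination h₁)
  have k₂ : M + ((a * c) ^ 2) ^ 2 - ((a * b) ^ 2 - (b * c) ^ 2) ^ 2 = 0 :=
    mul_left_cancel₀ hp.ne' (by linear_combination h₂)
  have k₃ : M + ((b * c) ^ 2) ^ 2 - ((a * b) ^ 2 - (a * c) ^ 2) ^ 2 = 0 :=
    mul_left_cancel₀ hp.ne' (by linear_combination h₃)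
  have hxy : (a * b) ^ 2 = (a * c) ^ 2 :=
    eq_of_cyclic_sq_sub (by positivity) (by positivity) k₁ k₂ k₃
  have hxz : (a * b) ^ 2 = (b * c) ^ 2 :=
    eq_of_cyclic_sq_sub (z := (a * c) ^ 2) (M := M) (by positivity) (by positivity)
      (by linear_combination k₁) (by linear_combination k₃) (by linear_combination k₂)
  have hbc : b = c := mul_left_cancel₀ ha.ne'
    ((pow_left_inj₀ (by positivity) (by positivity) two_ne_zero).mp hxy)
  have hac : a = c := mul_left_cancel₀ hb.ne' (by
    rw [mul_comm b a]
    exact (pow_left_inj₀ (by positivity) (by positivity) two_ne_zero).mp hxz)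
  subst hbc hac
  refine ⟨rfl, rfl, mul_left_cancel₀ (pow_ne_zero 3 ha.ne') ?_⟩
  linear_combination hM + p * k₁

/-- Any solution of (S0) with positive `a,…,f` is the standard one:
`a = b = c = d = e = f = 1` and `μ = -1`. -/
theorem systemS0_unique_positive_solution
    (a b c d e f μ : ℝ)
    (ha : 0 < a) (hb : 0 < b) (hc : 0 < c)
    (hd : 0 < d) (he : 0 < e) (hf : 0 < f)
    (hsol : SystemS0 a b c d e f μ) :
    a = 1 ∧ b = 1 ∧ c = 1 ∧ d = 1 ∧ e = 1 ∧ f = 1 ∧ μ = -1 := by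
  obtain ⟨h₀, h₁, h₂, h₃, h₄, h₅, h₆⟩ := hsol
  obtain ⟨rfl, rfl, hμ⟩ := eq_of_half_system (p := d * e * f) (μ := μ) ha hb hc (by positivity)
    (by linear_combination h₁) (by linear_combination h₂) (by linear_combination h₃)
  obtain ⟨rfl, rfl, hμ'⟩ := eq_of_half_system (p := c * c * c) (μ := μ) hd he hf (by positivity)
    (by linear_combination h₄) (by linear_combination h₅) (by linear_combination h₆)
  have hsq : c ^ 2 = f ^ 2 := mul_left_cancel₀ (by positivity : c ^ 3 * f ^ 3 ≠ 0)
    (by linear_combination hμ - hμ')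
  obtain rfl : c = f := (pow_left_inj₀ hc.le hf.le two_ne_zero).mp hsq
  obtain rfl : c = 1 :=
    (pow_eq_one_iff_of_nonneg hc.le (by norm_num : 6 ≠ 0)).mp (by linear_combination h₀)
  exact ⟨rfl, rfl, rfl, rfl, rfl, rfl, by linarith⟩
end

section
/- A tuple (A,B,C,D,E,F,X,Y,Z,μ) ∈ ℝ¹⁰ with A,B,C,D,E,F > 0 solves the system (S1) if and only if it belongs to the following set: (i) A=B=C=D=E=F=1, X=Y=Z=0, μ=−1; (ii) A=B=C=D=E=F=1, X,Y,Z ∈ {−1,1} with XYZ=1, μ=−1; (iii) A=B=C=1/√2, D=E=F=√2, X,Y,Z ∈ {−1,1} with XYZ=1, μ=−1; (iv) A=B=C=3^{1/4}/√2, D=E=F=√2/3^{1/4}, X,Y,Z ∈ {−1/√3, 1/√3} with XYZ=1/(3√3), μ=−5/(3√3). -/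
open Real

/-- The system (S1) of 10 polynomial equations arising from left-invariant Einstein
metrics on S³×S³ invariant under a ℤ₂×ℤ₂ subgroup of inner automorphisms. -/
def SystemS1 (A B C D E F X Y Z μ : ℝ) : Prop :=
  A*B*C*D*E*F - 1 = 0 ∧
  B*C*D*E*F*μ - A*Y^2*Z^2 + D*X*Y*Z - A*Y^2 - A*Z^2 + B*Z^2 + C*Y^2 - A + B + C = 0 ∧
  A*C*D*E*F*μ - B*X^2*Z^2 + E*X*Y*Z - B*Z^2 - B*X^2 + C*X^2 + A*Z^2 + A - B + C = 0 ∧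
  A*B*D*E*F*μ - C*X^2*Y^2 + F*X*Y*Z - C*X^2 - C*Y^2 + A*Y^2 + B*X^2 + A + B - C = 0 ∧
  A*B*C*E*F*μ + A*X*Y*Z - D*X^2 - D + E + F = 0 ∧
  A*B*C*D*F*μ + B*X*Y*Z - E*Y^2 + D - E + F = 0 ∧
  A*B*C*D*E*μ + C*X*Y*Z - F*Z^2 + D + E - F = 0 ∧
  -B^2*X*Z^2 - C^2*X*Y^2 - B^2*X - C^2*X + A*D*Y*Z + B*E*Y*Z + C*F*Y*Z + 2*B*C*X - D^2*X = 0 ∧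
  -C^2*X^2*Y - A^2*Y*Z^2 - C^2*Y - A^2*Y + A*D*X*Z + B*E*X*Z + C*F*X*Z + 2*A*C*Y - E^2*Y = 0 ∧
  -A^2*Y^2*Z - B^2*X^2*Z - A^2*Z - B^2*Z + A*D*X*Y + B*E*X*Y + C*F*X*Y + 2*A*B*Z - F^2*Z = 0

/-- The critical-point equations of the scalar curvature in polar coordinates: `c` and `s` are the
cosines and sines of the angles between the two factors, `u` and `w` rescale the remaining
parameters so that the system is symmetric under exchanging `u` and `w`. -/
structure PolarSystem (u₁ w₁ c₁ s₁ u₂ w₂ c₂ s₂ u₃ w₃ c₃ s₃ ν : ℝ) : Prop where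
  hu₁ : 0 < u₁
  hu₂ : 0 < u₂
  hu₃ : 0 < u₃
  hw₁ : 0 < w₁
  hw₂ : 0 < w₂
  hw₃ : 0 < w₃
  hc₁ : 0 < c₁
  hc₂ : 0 < c₂
  hc₃ : 0 < c₃
  hs₁ : 0 < s₁
  hs₂ : 0 < s₂
  hs₃ : 0 < s₃
  circ₁ : c₁ ^ 2 + s₁ ^ 2 = 1
  circ₂ : c₂ ^ 2 + s₂ ^ 2 = 1
  circ₃ : c₃ ^ 2 + s₃ ^ 2 = 1
  eu₁ : u₁ ^ 2 + ν = c₁ * u₁ * (c₂ * u₂ + c₃ * u₃) + s₁ * s₂ * s₃ * u₁ * w₁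
  eu₂ : u₂ ^ 2 + ν = c₂ * u₂ * (c₃ * u₃ + c₁ * u₁) + s₁ * s₂ * s₃ * u₂ * w₂
  eu₃ : u₃ ^ 2 + ν = c₃ * u₃ * (c₁ * u₁ + c₂ * u₂) + s₁ * s₂ * s₃ * u₃ * w₃
  ew₁ : w₁ ^ 2 + ν = c₁ * w₁ * (c₂ * w₂ + c₃ * w₃) + s₁ * s₂ * s₃ * u₁ * w₁
  ew₂ : w₂ ^ 2 + ν = c₂ * w₂ * (c₃ * w₃ + c₁ * w₁) + s₁ * s₂ * s₃ * u₂ * w₂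
  ew₃ : w₃ ^ 2 + ν = c₃ * w₃ * (c₁ * w₁ + c₂ * w₂) + s₁ * s₂ * s₃ * u₃ * w₃
  es₁ : s₁ * (u₂ ^ 2 + u₃ ^ 2 - 2 * c₂ * c₃ * u₂ * u₃ + w₁ ^ 2) =
    s₂ * s₃ * (u₁ * w₁ + u₂ * w₂ + u₃ * w₃)
  es₂ : s₂ * (u₃ ^ 2 + u₁ ^ 2 - 2 * c₃ * c₁ * u₃ * u₁ + w₂ ^ 2) =
    s₃ * s₁ * (u₁ * w₁ + u₂ * w₂ + u₃ * w₃)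
  es₃ : s₃ * (u₁ ^ 2 + u₂ ^ 2 - 2 * c₁ * c₂ * u₁ * u₂ + w₃ ^ 2) =
    s₁ * s₂ * (u₁ * w₁ + u₂ * w₂ + u₃ * w₃)

/-- A symmetric linear system whose matrix is positive definite has only the zero solution. -/
lemma eq_zero_of_posDef_system {α β τ k c u w a b γ : ℝ} (hα : 1 ≤ α) (hβ : 1 ≤ β)
    (hτ : 0 < τ) (hτ1 : τ < 1) (hτc : τ ≤ 1 - c ^ 2) (hk : u ^ 2 + w ^ 2 < k)
    (ha : α * a = c * u * γ + τ * b) (hb : β * b = c * w * γ + τ * a)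
    (hγ : k * γ = c * (u * a + w * b)) : a = 0 ∧ b = 0 ∧ γ = 0 := by
  have form : (α - 1) * a ^ 2 + (β - 1) * b ^ 2 + (1 - τ - c ^ 2) * (a ^ 2 + b ^ 2)
      + τ * (a - b) ^ 2 + (c * a - u * γ) ^ 2 + (c * b - w * γ) ^ 2
      + (k - u ^ 2 - w ^ 2) * γ ^ 2 = 0 := by
    linear_combination a * ha + b * hb + γ * hγ
  have h₁ : 0 ≤ (α - 1) * a ^ 2 := mul_nonneg (by linarith) (sq_nonneg a)
  have h₂ : 0 ≤ (β - 1) * b ^ 2 := mul_nonneg (by linarith) (sq_nonneg b)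
  have h₃ : 0 ≤ (1 - τ - c ^ 2) * (a ^ 2 + b ^ 2) := mul_nonneg (by linarith) (by positivity)
  have h₄ : 0 ≤ τ * (a - b) ^ 2 := by positivity
  have h₅ : 0 ≤ (k - u ^ 2 - w ^ 2) * γ ^ 2 := mul_nonneg (by linarith) (sq_nonneg γ)
  have hγ0 : γ = 0 := by
    have : (k - u ^ 2 - w ^ 2) * γ ^ 2 = 0 := by
      nlinarith [sq_nonneg (c * a - u * γ), sq_nonneg (c * b - w * γ)]
    rcases mul_eq_zero.1 this with h | h
    · linarith
    · exact pow_eq_zero_iff (two_ne_zero) |>.1 h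
  subst hγ0
  have hab : a = b := by
    have : τ * (a - b) ^ 2 = 0 := by
      nlinarith [sq_nonneg (c * a - u * 0), sq_nonneg (c * b - w * 0)]
    rcases mul_eq_zero.1 this with h | h
    · linarith
    · linarith [pow_eq_zero_iff (two_ne_zero) |>.1 h]
  subst hab
  have : (α - τ) * a = 0 := by linear_combination ha
  have ha0 : a = 0 := (mul_eq_zero.1 this).resolve_left (by linarith)
  exact ⟨ha0, ha0, rfl⟩

/-- A diagonally dominant `2 × 2` system with nonpositive off-diagonal entries is inverse
positive. -/
lemma nonneg_of_dominant_system {α β τ p q a b : ℝ} (hτ : 0 < τ) (hα : τ < α) (hβ : τ < β)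
    (hp : 0 ≤ p) (hq : 0 ≤ q) (ha : α * a = p + τ * b) (hb : β * b = q + τ * a) :
    0 ≤ a ∧ 0 ≤ b := by
  have hdet : 0 < α * β - τ ^ 2 := by nlinarith
  have hβ0 : 0 < β := hτ.trans hβ
  have hα0 : 0 < α := hτ.trans hα
  constructor
  · have h : (α * β - τ ^ 2) * a = β * p + τ * q := by linear_combination β * ha + τ * hb
    exact nonneg_of_mul_nonneg_right (h ▸ by positivity : 0 ≤ (α * β - τ ^ 2) * a) hdet
  · have h : (α * β - τ ^ 2) * b = α * q + τ * p := by linear_combination α * hb + τ * ha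
    exact nonneg_of_mul_nonneg_right (h ▸ by positivity : 0 ≤ (α * β - τ ^ 2) * b) hdet

namespace PolarSystem

variable {u₁ w₁ c₁ s₁ u₂ w₂ c₂ s₂ u₃ w₃ c₃ s₃ ν : ℝ}

lemma rotate (h : PolarSystem u₁ w₁ c₁ s₁ u₂ w₂ c₂ s₂ u₃ w₃ c₃ s₃ ν) :
    PolarSystem u₂ w₂ c₂ s₂ u₃ w₃ c₃ s₃ u₁ w₁ c₁ s₁ ν where
  hu₁ := h.hu₂
  hu₂ := h.hu₃
  hu₃ := h.hu₁
  hw₁ := h.hw₂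
  hw₂ := h.hw₃
  hw₃ := h.hw₁
  hc₁ := h.hc₂
  hc₂ := h.hc₃
  hc₃ := h.hc₁
  hs₁ := h.hs₂
  hs₂ := h.hs₃
  hs₃ := h.hs₁
  circ₁ := h.circ₂
  circ₂ := h.circ₃
  circ₃ := h.circ₁
  eu₁ := by linear_combination h.eu₂
  eu₂ := by linear_combination h.eu₃
  eu₃ := by linear_combination h.eu₁
  ew₁ := by linear_combination h.ew₂
  ew₂ := by linear_combination h.ew₃
  ew₃ := by linear_combination h.ew₁
  es₁ := by linear_combination h.es₂
  es₂ := by linear_combination h.es₃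
  es₃ := by linear_combination h.es₁

lemma swap (h : PolarSystem u₁ w₁ c₁ s₁ u₂ w₂ c₂ s₂ u₃ w₃ c₃ s₃ ν) :
    PolarSystem u₂ w₂ c₂ s₂ u₁ w₁ c₁ s₁ u₃ w₃ c₃ s₃ ν where
  hu₁ := h.hu₂
  hu₂ := h.hu₁
  hu₃ := h.hu₃
  hw₁ := h.hw₂
  hw₂ := h.hw₁
  hw₃ := h.hw₃
  hc₁ := h.hc₂
  hc₂ := h.hc₁
  hc₃ := h.hc₃
  hs₁ := h.hs₂
  hs₂ := h.hs₁
  hs₃ := h.hs₃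
  circ₁ := h.circ₂
  circ₂ := h.circ₁
  circ₃ := h.circ₃
  eu₁ := by linear_combination h.eu₂
  eu₂ := by linear_combination h.eu₁
  eu₃ := by linear_combination h.eu₃
  ew₁ := by linear_combination h.ew₂
  ew₂ := by linear_combination h.ew₁
  ew₃ := by linear_combination h.ew₃
  es₁ := by linear_combination h.es₂
  es₂ := by linear_combination h.es₁
  es₃ := by linear_combination h.es₃

lemma dual (h : PolarSystem u₁ w₁ c₁ s₁ u₂ w₂ c₂ s₂ u₃ w₃ c₃ s₃ ν) :
    PolarSystem w₁ u₁ c₁ s₁ w₂ u₂ c₂ s₂ w₃ u₃ c₃ s₃ ν where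
  hu₁ := h.hw₁
  hu₂ := h.hw₂
  hu₃ := h.hw₃
  hw₁ := h.hu₁
  hw₂ := h.hu₂
  hw₃ := h.hu₃
  hc₁ := h.hc₁
  hc₂ := h.hc₂
  hc₃ := h.hc₃
  hs₁ := h.hs₁
  hs₂ := h.hs₂
  hs₃ := h.hs₃
  circ₁ := h.circ₁
  circ₂ := h.circ₂
  circ₃ := h.circ₃
  eu₁ := by linear_combination h.ew₁
  eu₂ := by linear_combination h.ew₂
  eu₃ := by linear_combination h.ew₃
  ew₁ := by linear_combination h.eu₁
  ew₂ := by linear_combination h.eu₂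
  ew₃ := by linear_combination h.eu₃
  es₁ := by
    linear_combination h.es₁ + s₁ * (h.eu₁ - h.eu₂ - h.eu₃ - h.ew₁ + h.ew₂ + h.ew₃)
  es₂ := by
    linear_combination h.es₂ + s₂ * (h.eu₂ - h.eu₃ - h.eu₁ - h.ew₂ + h.ew₃ + h.ew₁)
  es₃ := by
    linear_combination h.es₃ + s₃ * (h.eu₃ - h.eu₁ - h.eu₂ - h.ew₃ + h.ew₁ + h.ew₂)

/-- The Cauchy–Schwarz inequality applied to the product of two of the angular equations. -/
lemma sin_mul_le (h : PolarSystem u₁ w₁ c₁ s₁ u₂ w₂ c₂ s₂ u₃ w₃ c₃ s₃ ν) :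
    s₂ * s₃ * u₁ ≤ s₁ * w₁ := by
  obtain ⟨hu₁, hu₂, hu₃, hw₁, hw₂, hw₃, hc₁, hc₂, hc₃, hs₁, hs₂, hs₃, circ₁, circ₂, circ₃,
    -, -, -, -, -, -, -, es₂, es₃⟩ := h
  have e₂ : u₃ ^ 2 + u₁ ^ 2 - 2 * c₃ * c₁ * u₃ * u₁ + w₂ ^ 2 =
      (s₁ * u₃) ^ 2 + w₂ ^ 2 + (s₃ * u₁) ^ 2 + (c₁ * u₃ - c₃ * u₁) ^ 2 := by
    linear_combination -u₃ ^ 2 * circ₁ - u₁ ^ 2 * circ₃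
  have e₃ : u₁ ^ 2 + u₂ ^ 2 - 2 * c₁ * c₂ * u₁ * u₂ + w₃ ^ 2 =
      w₃ ^ 2 + (s₁ * u₂) ^ 2 + (s₂ * u₁) ^ 2 + (c₁ * u₂ - c₂ * u₁) ^ 2 := by
    linear_combination -u₁ ^ 2 * circ₂ - u₂ ^ 2 * circ₁
  set T := u₁ * w₁ + u₂ * w₂ + u₃ * w₃ with hT
  have hT0 : 0 < T := by positivity
  have cauchy : ∀ a b c d e f p q : ℝ, (a * d + b * e + c * f) ^ 2 ≤
      (a ^ 2 + b ^ 2 + c ^ 2 + p ^ 2) * (d ^ 2 + e ^ 2 + f ^ 2 + q ^ 2) := by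
    intro a b c d e f p q
    linarith [sq_nonneg (a * e - b * d), sq_nonneg (a * f - c * d), sq_nonneg (b * f - c * e),
      sq_nonneg (a * q), sq_nonneg (b * q), sq_nonneg (c * q), sq_nonneg (p * d),
      sq_nonneg (p * e), sq_nonneg (p * f), sq_nonneg (p * q)]
  rw [e₂] at es₂
  rw [e₃] at es₃
  have prod : ((s₁ * u₃) ^ 2 + w₂ ^ 2 + (s₃ * u₁) ^ 2 + (c₁ * u₃ - c₃ * u₁) ^ 2) *
      (w₃ ^ 2 + (s₁ * u₂) ^ 2 + (s₂ * u₁) ^ 2 + (c₁ * u₂ - c₂ * u₁) ^ 2) = (s₁ * T) ^ 2 := by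
    have h23 : s₂ * s₃ ≠ 0 := by positivity
    apply mul_left_cancel₀ h23
    calc _ = (s₂ * ((s₁ * u₃) ^ 2 + w₂ ^ 2 + (s₃ * u₁) ^ 2 + (c₁ * u₃ - c₃ * u₁) ^ 2)) *
          (s₃ * (w₃ ^ 2 + (s₁ * u₂) ^ 2 + (s₂ * u₁) ^ 2 + (c₁ * u₂ - c₂ * u₁) ^ 2)) := by ring
      _ = _ := by rw [es₂, es₃]; ring
  have key := cauchy (s₁ * u₃) w₂ (s₃ * u₁) w₃ (s₁ * u₂) (s₂ * u₁) (c₁ * u₃ - c₃ * u₁)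
    (c₁ * u₂ - c₂ * u₁)
  rw [prod] at key
  have hle := le_of_sq_le_sq key (by positivity)
  have : u₁ * (s₂ * s₃ * u₁) ≤ u₁ * (s₁ * w₁) := by rw [hT] at hle; linarith
  exact le_of_mul_le_mul_left this hu₁

lemma mul_sin_le_sin (h : PolarSystem u₁ w₁ c₁ s₁ u₂ w₂ c₂ s₂ u₃ w₃ c₃ s₃ ν) :
    s₂ * s₃ ≤ s₁ := by
  have h₁ := h.sin_mul_le
  have h₂ := h.dual.sin_mul_le
  have hpos : 0 < u₁ + w₁ := add_pos h.hu₁ h.hw₁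
  refine le_of_mul_le_mul_right ?_ hpos
  linarith

lemma sin_lt_one (h : PolarSystem u₁ w₁ c₁ s₁ u₂ w₂ c₂ s₂ u₃ w₃ c₃ s₃ ν) : s₁ < 1 := by
  have := h.hc₁
  nlinarith [h.circ₁, h.hs₁]

lemma mul_sin_le (h : PolarSystem u₁ w₁ c₁ s₁ u₂ w₂ c₂ s₂ u₃ w₃ c₃ s₃ ν) :
    s₁ * s₂ * s₃ ≤ 1 - c₁ ^ 2 := by
  have := mul_le_mul_of_nonneg_left h.mul_sin_le_sin h.hs₁.le
  linarith [h.circ₁]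

/-- The coupling term is dominated by the square of the sine. -/
lemma coupling_le (h : PolarSystem u₁ w₁ c₁ s₁ u₂ w₂ c₂ s₂ u₃ w₃ c₃ s₃ ν) :
    s₁ * s₂ * s₃ * w₁ ≤ (1 - c₁ ^ 2) * u₁ := by
  have := mul_le_mul_of_nonneg_left h.dual.sin_mul_le h.hs₁.le
  linear_combination this + u₁ * h.circ₁

/-- The stiffness coefficient of `u` for the indices `2` and `3`. -/
lemma stiffness_eq (h : PolarSystem u₁ w₁ c₁ s₁ u₂ w₂ c₂ s₂ u₃ w₃ c₃ s₃ ν) :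
    (1 + c₂ * c₃ - ν / (u₂ * u₃)) * u₃ = u₂ + u₃ - c₁ * c₂ * u₁ - s₁ * s₂ * s₃ * w₂ := by
  have := h.hu₂.ne'
  have := h.hu₃.ne'
  field_simp
  linear_combination -h.eu₂

lemma stiffness_mul_sub (h : PolarSystem u₁ w₁ c₁ s₁ u₂ w₂ c₂ s₂ u₃ w₃ c₃ s₃ ν) :
    (1 + c₂ * c₃ - ν / (u₂ * u₃)) * (u₃ - u₂) =
      c₁ * u₁ * (c₃ - c₂) + s₁ * s₂ * s₃ * (w₃ - w₂) := by
  have := h.hu₂.ne'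
  have := h.hu₃.ne'
  field_simp
  linear_combination u₂ * h.eu₃ - u₃ * h.eu₂

lemma one_le_stiffness (h : PolarSystem u₁ w₁ c₁ s₁ u₂ w₂ c₂ s₂ u₃ w₃ c₃ s₃ ν)
    (hle : c₁ * u₁ ≤ c₂ * u₂) : 1 ≤ 1 + c₂ * c₃ - ν / (u₂ * u₃) := by
  have h₁ := h.stiffness_eq
  have h₂ := h.rotate.coupling_le
  refine le_of_mul_le_mul_right ?_ h.hu₃
  rw [h₁]
  nlinarith [mul_le_mul_of_nonneg_left hle h.hc₂.le]

lemma le_triangle (h : PolarSystem u₁ w₁ c₁ s₁ u₂ w₂ c₂ s₂ u₃ w₃ c₃ s₃ ν) (hν : 0 ≤ ν) :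
    c₁ * u₁ ≤ c₂ * u₂ + c₃ * u₃ := by
  have h₂ := mul_le_mul_of_nonneg_left h.coupling_le h.hu₁.le
  have hpos := mul_pos h.hc₁ h.hu₁
  refine le_of_mul_le_mul_left ?_ hpos
  nlinarith [h.eu₁]

lemma coupling_lt_stiffness (h : PolarSystem u₁ w₁ c₁ s₁ u₂ w₂ c₂ s₂ u₃ w₃ c₃ s₃ ν) :
    s₁ * s₂ * s₃ < 1 + c₂ * c₃ - ν / (u₂ * u₃) := by
  have hcs : s₂ * s₃ ≤ 1 - c₂ * c₃ := by
    nlinarith [sq_nonneg (c₂ - c₃), sq_nonneg (s₂ - s₃), h.circ₂, h.circ₃]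
  have hss : s₁ * s₂ * s₃ < s₂ * s₃ := by
    have := mul_lt_mul_of_pos_right h.sin_lt_one (mul_pos h.hs₂ h.hs₃)
    linarith
  have hcc := mul_pos h.hc₂ h.hc₃
  rcases le_total ν 0 with hν | hν
  · have : ν / (u₂ * u₃) ≤ 0 := div_nonpos_of_nonpos_of_nonneg hν (mul_pos h.hu₂ h.hu₃).le
    linarith
  · refine (hss.trans_le hcs).trans_le (le_of_mul_le_mul_right ?_ h.hu₃)
    rw [h.stiffness_eq]
    have h₁ := h.le_triangle hν
    have h₂ := h.rotate.coupling_le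
    nlinarith [mul_le_mul_of_nonneg_left h₁ h.hc₂.le]

lemma mono (h : PolarSystem u₁ w₁ c₁ s₁ u₂ w₂ c₂ s₂ u₃ w₃ c₃ s₃ ν) (hc : c₂ ≤ c₃) :
    u₂ ≤ u₃ ∧ w₂ ≤ w₃ := by
  have hτ : 0 < s₁ * s₂ * s₃ := mul_pos (mul_pos h.hs₁ h.hs₂) h.hs₃
  have key := nonneg_of_dominant_system hτ h.coupling_lt_stiffness h.dual.coupling_lt_stiffness
    (mul_nonneg (mul_pos h.hc₁ h.hu₁).le (sub_nonneg.2 hc))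
    (mul_nonneg (mul_pos h.hc₁ h.hw₁).le (sub_nonneg.2 hc))
    h.stiffness_mul_sub h.dual.stiffness_mul_sub
  exact ⟨sub_nonneg.1 key.1, sub_nonneg.1 key.2⟩

/-- The difference of the angular equations for the indices `2` and `3`. -/
lemma angular_sub (h : PolarSystem u₁ w₁ c₁ s₁ u₂ w₂ c₂ s₂ u₃ w₃ c₃ s₃ ν) :
    (u₁ * w₁ + u₂ * w₂ + u₃ * w₃) * s₁ * (c₃ ^ 2 - c₂ ^ 2) =
      s₂ * s₃ * c₁ * (u₁ * (c₃ * u₃ - c₂ * u₂) + w₁ * (c₃ * w₃ - c₂ * w₂)) := by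
  linear_combination s₃ / 2 * (h.es₂ + h.dual.es₂) - s₂ / 2 * (h.es₃ + h.dual.es₃)
    + (u₁ * w₁ + u₂ * w₂ + u₃ * w₃) * s₁ * (h.circ₃ - h.circ₂)

/-- Equality of two indices, given enough stiffness in all directions. -/
lemma eq_of_stiff (h : PolarSystem u₁ w₁ c₁ s₁ u₂ w₂ c₂ s₂ u₃ w₃ c₃ s₃ ν)
    (hα : 1 ≤ 1 + c₂ * c₃ - ν / (u₂ * u₃)) (hβ : 1 ≤ 1 + c₂ * c₃ - ν / (w₂ * w₃))
    (hk : u₁ ^ 2 + w₁ ^ 2 < 2 * (u₁ * w₁ + u₂ * w₂ + u₃ * w₃) * s₁ / (s₂ * s₃)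
      - c₁ * (u₁ * (u₂ + u₃) + w₁ * (w₂ + w₃)) / (c₂ + c₃)) :
    u₂ = u₃ ∧ w₂ = w₃ ∧ c₂ = c₃ := by
  have hτ : 0 < s₁ * s₂ * s₃ := mul_pos (mul_pos h.hs₁ h.hs₂) h.hs₃
  have hτ₁ : s₁ * s₂ * s₃ < 1 := by
    have := h.mul_sin_le
    have := pow_pos h.hc₁ 2
    linarith
  have hγ : (2 * (u₁ * w₁ + u₂ * w₂ + u₃ * w₃) * s₁ / (s₂ * s₃)
      - c₁ * (u₁ * (u₂ + u₃) + w₁ * (w₂ + w₃)) / (c₂ + c₃)) * (c₃ - c₂) =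
      c₁ * (u₁ * (u₃ - u₂) + w₁ * (w₃ - w₂)) := by
    have := h.hs₂.ne'
    have := h.hs₃.ne'
    have := (add_pos h.hc₂ h.hc₃).ne'
    field_simp
    linear_combination 2 * h.angular_sub
  have hb := h.dual.stiffness_mul_sub
  obtain ⟨h₁, h₂, h₃⟩ := eq_zero_of_posDef_system hα hβ hτ hτ₁ h.mul_sin_le hk
    h.stiffness_mul_sub hb hγ
  exact ⟨by linarith, by linarith, by linarith⟩

lemma sin_le_sin (h : PolarSystem u₁ w₁ c₁ s₁ u₂ w₂ c₂ s₂ u₃ w₃ c₃ s₃ ν) (hc : c₁ ≤ c₂) :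
    s₂ ≤ s₁ := by
  have := h.hc₁
  refine le_of_sq_le_sq ?_ h.hs₁.le
  nlinarith [h.circ₁, h.circ₂]

lemma sum_sq_le (h : PolarSystem u₁ w₁ c₁ s₁ u₂ w₂ c₂ s₂ u₃ w₃ c₃ s₃ ν) (hs₁₂ : s₂ ≤ s₁)
    (hs₁₃ : s₃ ≤ s₁) : u₁ ^ 2 + w₁ ^ 2 + u₂ ^ 2 + w₂ ^ 2 + u₃ ^ 2 + w₃ ^ 2 ≤
      2 * (u₁ * w₁ + u₂ * w₂ + u₃ * w₃) * s₁ / (s₂ * s₃) := by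
  have r₁ := h.sin_mul_le
  have r₁' := h.dual.sin_mul_le
  have r₂ := h.rotate.sin_mul_le
  have r₂' := h.rotate.dual.sin_mul_le
  have r₃ := h.rotate.rotate.sin_mul_le
  have r₃' := h.rotate.rotate.dual.sin_mul_le
  obtain ⟨hu₁, hu₂, hu₃, hw₁, hw₂, hw₃, -, -, -, hs₁, hs₂, hs₃, -⟩ := h
  have bound₂ : ∀ {p q : ℝ}, 0 < p → 0 < q → s₃ * s₁ * p ≤ s₂ * q → s₂ * s₃ * p ≤ s₁ * q := by
    intro p q hp hq hpq
    have h₁ := mul_le_mul_of_nonneg_right hs₁₂ (mul_pos hs₃ hp).le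
    have h₂ := mul_le_mul_of_nonneg_right hs₁₂ hq.le
    linarith
  have bound₃ : ∀ {p q : ℝ}, 0 < p → 0 < q → s₁ * s₂ * p ≤ s₃ * q → s₂ * s₃ * p ≤ s₁ * q := by
    intro p q hp hq hpq
    have h₁ := mul_le_mul_of_nonneg_right hs₁₃ (mul_pos hs₂ hp).le
    have h₂ := mul_le_mul_of_nonneg_right hs₁₃ hq.le
    linarith
  rw [le_div_iff₀ (mul_pos hs₂ hs₃)]
  linarith [mul_le_mul_of_nonneg_left r₁ hu₁.le, mul_le_mul_of_nonneg_left r₁' hw₁.le,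
    mul_le_mul_of_nonneg_left (bound₂ hu₂ hw₂ r₂) hu₂.le,
    mul_le_mul_of_nonneg_left (bound₂ hw₂ hu₂ r₂') hw₂.le,
    mul_le_mul_of_nonneg_left (bound₃ hu₃ hw₃ r₃) hu₃.le,
    mul_le_mul_of_nonneg_left (bound₃ hw₃ hu₃ r₃') hw₃.le]

/-- If the first cosine is the smallest, the other two indices agree. -/
lemma eq_of_le (h : PolarSystem u₁ w₁ c₁ s₁ u₂ w₂ c₂ s₂ u₃ w₃ c₃ s₃ ν) (h₁₂ : c₁ ≤ c₂)
    (h₁₃ : c₁ ≤ c₃) : u₂ = u₃ ∧ w₂ = w₃ ∧ c₂ = c₃ := by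
  obtain ⟨hu₁₂, hw₁₂⟩ := h.rotate.rotate.mono h₁₂
  obtain ⟨hu₁₃, hw₁₃⟩ := h.swap.mono h₁₃
  have lower := h.sum_sq_le (h.sin_le_sin h₁₂) (h.swap.rotate.sin_le_sin h₁₃)
  have stiff := h.one_le_stiffness (mul_le_mul h₁₂ hu₁₂ h.hu₁.le h.hc₂.le)
  have stiff' := h.dual.one_le_stiffness (mul_le_mul h₁₂ hw₁₂ h.hw₁.le h.hc₂.le)
  refine h.eq_of_stiff stiff stiff' ?_
  obtain ⟨hu₁, hu₂, hu₃, hw₁, hw₂, hw₃, -, hc₂, hc₃, -⟩ := h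
  have upper : c₁ * (u₁ * (u₂ + u₃) + w₁ * (w₂ + w₃)) / (c₂ + c₃) ≤
      (u₂ ^ 2 + w₂ ^ 2 + u₃ ^ 2 + w₃ ^ 2) / 2 := by
    rw [div_le_iff₀ (add_pos hc₂ hc₃)]
    have h₁ : u₁ * (u₂ + u₃) + w₁ * (w₂ + w₃) ≤ u₂ ^ 2 + w₂ ^ 2 + u₃ ^ 2 + w₃ ^ 2 := by
      nlinarith
    have h₂ : c₁ ≤ (c₂ + c₃) / 2 := by linarith
    have := mul_le_mul h₂ h₁ (by positivity) (by positivity)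
    linarith
  have : 0 < u₂ ^ 2 + w₂ ^ 2 + u₃ ^ 2 + w₃ ^ 2 := by positivity
  linarith

/-- If the first cosine is the smallest and the other two indices agree, all indices agree. -/
lemma eq_of_eq (h : PolarSystem u₁ w₁ c₁ s₁ u₂ w₂ c₂ s₂ u₂ w₂ c₂ s₂ ν) (h₁₂ : c₁ ≤ c₂) :
    u₁ = u₂ ∧ w₁ = w₂ ∧ c₁ = c₂ := by
  have r := h.rotate.sin_mul_le
  have r' := h.rotate.dual.sin_mul_le
  have ang := h.rotate.angular_sub
  suffices hk : _ by
    obtain ⟨h₁, h₂, h₃⟩ := h.rotate.eq_of_stiff (h.rotate.one_le_stiffness le_rfl)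
      (h.rotate.dual.one_le_stiffness le_rfl) hk
    exact ⟨h₁.symm, h₂.symm, h₃.symm⟩
  obtain ⟨hu₁, hu₂, -, hw₁, hw₂, -, hc₁, hc₂, -, hs₁, hs₂, -⟩ := h
  have hT : s₁ * (u₂ ^ 2 + w₂ ^ 2) ≤ 2 * (u₂ * w₂) := by
    have h₁ : s₁ * u₂ ≤ w₂ := le_of_mul_le_mul_left (by linarith) hs₂
    have h₂ : s₁ * w₂ ≤ u₂ := le_of_mul_le_mul_left (by linarith) hs₂
    linarith [mul_le_mul_of_nonneg_left h₁ hu₂.le, mul_le_mul_of_nonneg_left h₂ hw₂.le]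
  have hcc : 0 ≤ c₂ ^ 2 - c₁ ^ 2 := by nlinarith
  have slope : c₂ * (u₁ * u₂ + w₁ * w₂) ≤ c₁ * (u₂ ^ 2 + w₂ ^ 2) := by
    have h₁ : (2 * (u₂ * w₂) + u₁ * w₁) * (c₂ ^ 2 - c₁ ^ 2) =
        s₁ * (c₂ * (c₂ * (u₂ ^ 2 + w₂ ^ 2) - c₁ * (u₁ * u₂ + w₁ * w₂))) := by
      apply mul_left_cancel₀ hs₂.ne'
      linear_combination -ang
    have h₂ : s₁ * (u₂ ^ 2 + w₂ ^ 2) ≤ 2 * (u₂ * w₂) + u₁ * w₁ := by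
      linarith [mul_pos hu₁ hw₁]
    have h₃ := mul_le_mul_of_nonneg_right h₂ hcc
    rw [h₁] at h₃
    refine le_of_mul_le_mul_left ?_ (mul_pos hs₁ hc₁)
    linarith
  have lower : 2 * (u₂ ^ 2 + w₂ ^ 2) < 2 * (u₂ * w₂ + u₂ * w₂ + u₁ * w₁) * s₂ / (s₂ * s₁) := by
    rw [lt_div_iff₀ (mul_pos hs₂ hs₁)]
    have h₁ : s₁ * (u₂ ^ 2 + w₂ ^ 2) < u₂ * w₂ + u₂ * w₂ + u₁ * w₁ := by
      linarith [mul_pos hu₁ hw₁]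
    linarith [mul_lt_mul_of_pos_left h₁ hs₂]
  have upper : c₂ * (u₂ * (u₂ + u₁) + w₂ * (w₂ + w₁)) / (c₂ + c₁) ≤ u₂ ^ 2 + w₂ ^ 2 := by
    rw [div_le_iff₀ (add_pos hc₂ hc₁)]
    linarith
  linarith

lemma eq_of_min (h : PolarSystem u₁ w₁ c₁ s₁ u₂ w₂ c₂ s₂ u₃ w₃ c₃ s₃ ν) (h₁₂ : c₁ ≤ c₂)
    (h₁₃ : c₁ ≤ c₃) :
    (u₁ = u₂ ∧ u₂ = u₃) ∧ (w₁ = w₂ ∧ w₂ = w₃) ∧ c₁ = c₂ ∧ c₂ = c₃ := by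
  obtain ⟨rfl, rfl, rfl⟩ := h.eq_of_le h₁₂ h₁₃
  obtain rfl : s₂ = s₃ :=
    le_antisymm (h.rotate.rotate.swap.rotate.sin_le_sin le_rfl) (h.rotate.sin_le_sin le_rfl)
  obtain ⟨rfl, rfl, rfl⟩ := h.eq_of_eq h₁₂
  simp

/-- All three indices of a solution agree. -/
lemma all_eq (h : PolarSystem u₁ w₁ c₁ s₁ u₂ w₂ c₂ s₂ u₃ w₃ c₃ s₃ ν) :
    (u₁ = u₂ ∧ u₂ = u₃) ∧ (w₁ = w₂ ∧ w₂ = w₃) ∧ c₁ = c₂ ∧ c₂ = c₃ := by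
  have cases : (c₁ ≤ c₂ ∧ c₁ ≤ c₃) ∨ (c₂ ≤ c₃ ∧ c₂ ≤ c₁) ∨ (c₃ ≤ c₁ ∧ c₃ ≤ c₂) := by
    grind
  rcases cases with ⟨h₁, h₂⟩ | ⟨h₁, h₂⟩ | ⟨h₁, h₂⟩
  · exact h.eq_of_min h₁ h₂
  · obtain ⟨⟨rfl, rfl⟩, ⟨rfl, rfl⟩, rfl, rfl⟩ := h.rotate.eq_of_min h₁ h₂
    simp
  · obtain ⟨⟨rfl, rfl⟩, ⟨rfl, rfl⟩, rfl, rfl⟩ := h.rotate.rotate.eq_of_min h₁ h₂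
    simp

end PolarSystem

/-- Solutions of (S1) with positive `X`, `Y`, `Z` in polar coordinates. -/
lemma SystemS1.polarSystem {A B C D E F X Y Z μ p q r : ℝ} (hA : 0 < A) (hB : 0 < B) (hC : 0 < C)
    (hD : 0 < D) (hE : 0 < E) (hF : 0 < F) (hX : 0 < X) (hY : 0 < Y) (hZ : 0 < Z)
    (hp : 0 < p) (hq : 0 < q) (hr : 0 < r) (hpX : p ^ 2 = 1 + X ^ 2) (hqY : q ^ 2 = 1 + Y ^ 2)
    (hrZ : r ^ 2 = 1 + Z ^ 2) (h : SystemS1 A B C D E F X Y Z μ) :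
    PolarSystem (A * (q * r)) (D * p) p⁻¹ (X / p) (B * (r * p)) (E * q) q⁻¹ (Y / q)
      (C * (p * q)) (F * r) r⁻¹ (Z / r) (-μ) := by
  obtain ⟨vol, hA', hB', hC', hD', hE', hF', hX', hY', hZ'⟩ := h
  refine ⟨by positivity, by positivity, by positivity, by positivity, by positivity,
    by positivity, by positivity, by positivity, by positivity, by positivity, by positivity,
    by positivity, ?_, ?_, ?_, ?_, ?_, ?_, ?_, ?_, ?_, ?_, ?_, ?_⟩
  · field_simp; linear_combination -hpX
  · field_simp; linear_combination -hqY
  · field_simp; linear_combination -hrZ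
  · field_simp
    linear_combination (A ^ 2 * r ^ 2 - A * C) * hqY + (A ^ 2 * (1 + Y ^ 2) - A * B) * hrZ
      - A * hA' + μ * vol
  · field_simp
    linear_combination (B ^ 2 * r ^ 2 - B * C) * hpX + (B ^ 2 * (1 + X ^ 2) - A * B) * hrZ
      - B * hB' + μ * vol
  · field_simp
    linear_combination (C ^ 2 * q ^ 2 - B * C) * hpX + (C ^ 2 * (1 + X ^ 2) - A * C) * hqY
      - C * hC' + μ * vol
  · field_simp
    linear_combination D ^ 2 * hpX - D * hD' + μ * vol
  · field_simp
    linear_combination E ^ 2 * hqY - E * hE' + μ * vol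
  · field_simp
    linear_combination F ^ 2 * hrZ - F * hF' + μ * vol
  · field_simp
    linear_combination X * B ^ 2 * hrZ + X * C ^ 2 * hqY - hX'
  · field_simp
    linear_combination Y * C ^ 2 * hpX + Y * A ^ 2 * hrZ - hY'
  · field_simp
    linear_combination Z * A ^ 2 * hqY + Z * B ^ 2 * hpX - hZ'

/-- Changing the signs of an even number of the off-diagonal parameters preserves (S1). -/
lemma SystemS1.abs {A B C D E F X Y Z μ : ℝ} (h : SystemS1 A B C D E F X Y Z μ)
    (hXYZ : 0 < X * Y * Z) : SystemS1 A B C D E F |X| |Y| |Z| μ := by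
  obtain ⟨vol, hA', hB', hC', hD', hE', hF', hX', hY', hZ'⟩ := h
  have sX := sq_abs X
  have sY := sq_abs Y
  have sZ := sq_abs Z
  have ht : |X| * |Y| * |Z| = X * Y * Z := by rw [← abs_mul, ← abs_mul, abs_of_pos hXYZ]
  have hX0 : |X| ≠ 0 := abs_ne_zero.2 fun h => by simp [h] at hXYZ
  have hY0 : |Y| ≠ 0 := abs_ne_zero.2 fun h => by simp [h] at hXYZ
  have hZ0 : |Z| ≠ 0 := abs_ne_zero.2 fun h => by simp [h] at hXYZ
  refine ⟨vol, ?_, ?_, ?_, ?_, ?_, ?_, mul_left_cancel₀ hX0 ?_, mul_left_cancel₀ hY0 ?_,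
    mul_left_cancel₀ hZ0 ?_⟩
  · linear_combination hA' + D * ht + (C - A - A * |Z| ^ 2) * sY + (B - A - A * Y ^ 2) * sZ
  · linear_combination hB' + E * ht + (C - B - B * |Z| ^ 2) * sX + (A - B - B * X ^ 2) * sZ
  · linear_combination hC' + F * ht + (B - C - C * |Y| ^ 2) * sX + (A - C - C * X ^ 2) * sY
  · linear_combination hD' + A * ht - D * sX
  · linear_combination hE' + B * ht - E * sY
  · linear_combination hF' + C * ht - F * sZ
  · linear_combination X * hX' + (A * D + B * E + C * F) * ht - B ^ 2 * X ^ 2 * sZ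
      - C ^ 2 * X ^ 2 * sY
      - (B ^ 2 * |Z| ^ 2 + C ^ 2 * |Y| ^ 2 + B ^ 2 + C ^ 2 - 2 * B * C + D ^ 2) * sX
  · linear_combination Y * hY' + (A * D + B * E + C * F) * ht - C ^ 2 * Y ^ 2 * sX
      - A ^ 2 * Y ^ 2 * sZ
      - (C ^ 2 * |X| ^ 2 + A ^ 2 * |Z| ^ 2 + C ^ 2 + A ^ 2 - 2 * A * C + E ^ 2) * sY
  · linear_combination Z * hZ' + (A * D + B * E + C * F) * ht - A ^ 2 * Z ^ 2 * sY
      - B ^ 2 * Z ^ 2 * sX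
      - (A ^ 2 * |Y| ^ 2 + B ^ 2 * |X| ^ 2 + A ^ 2 + B ^ 2 - 2 * A * B + F ^ 2) * sZ

/-- With `X = Y = Z = 0` the two factors decouple. -/
lemma eq_of_decoupled {A B C μ : ℝ} (hA : 0 < A) (hB : 0 < B) (hC : 0 < C)
    (h₁ : μ = A ^ 2 - A * B - A * C) (h₂ : μ = B ^ 2 - A * B - B * C)
    (h₃ : μ = C ^ 2 - A * C - B * C) : A = B ∧ A = C := by
  have e₁ : (A - B) * (A + B - C) = 0 := by linear_combination h₂ - h₁
  have e₂ : (A - C) * (A + C - B) = 0 := by linear_combination h₃ - h₁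
  have e₃ : (B - C) * (B + C - A) = 0 := by linear_combination h₃ - h₂
  rcases mul_eq_zero.1 e₁ with h | h <;> rcases mul_eq_zero.1 e₂ with h' | h' <;>
    rcases mul_eq_zero.1 e₃ with h'' | h'' <;> constructor <;> linarith

/-- Symmetric solutions of (S1). -/
lemma systemS1_of_symmetric {A D X Y Z μ x k : ℝ} (hAD : A * D = 1) (hX : X ^ 2 = x)
    (hY : Y ^ 2 = x) (hZ : Z ^ 2 = x) (hYZ : Y * Z = k * X) (hXZ : X * Z = k * Y)
    (hXY : X * Y = k * Z) (hA : D * μ - A * (1 + x) ^ 2 + D * k * x + 2 * A * (1 + x) = 0)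
    (hD : A * μ + A * k * x - D * (1 + x) + 2 * D = 0) (hk : 3 * k = 2 * A ^ 2 * x + D ^ 2) :
    SystemS1 A A A D D D X Y Z μ := by
  have hA3 : A * A * A * D * D * D = 1 := by
    linear_combination ((A * D) ^ 2 + A * D + 1) * hAD
  have hA2 : A * A * D * D * D * μ = D * μ := by
    linear_combination D * μ * (A * D + 1) * hAD
  have hD2 : A * A * A * D * D * μ = A * μ := by
    linear_combination A * μ * (A * D + 1) * hAD
  have ht : X * Y * Z = k * x := by linear_combination X * hYZ + k * hX
  refine ⟨?_, ?_, ?_, ?_, ?_, ?_, ?_, ?_, ?_, ?_⟩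
  · linear_combination hA3
  · linear_combination hA2 + hA + D * ht - A * Z ^ 2 * hY - A * x * hZ
  · linear_combination hA2 + hA + D * ht - A * Z ^ 2 * hX - A * x * hZ
  · linear_combination hA2 + hA + D * ht - A * Y ^ 2 * hX - A * x * hY
  · linear_combination hD2 + hD + A * ht - D * hX
  · linear_combination hD2 + hD + A * ht - D * hY
  · linear_combination hD2 + hD + A * ht - D * hZ
  · linear_combination 3 * A * D * hYZ + 3 * k * X * hAD + X * hk - A ^ 2 * X * (hY + hZ)
  · linear_combination 3 * A * D * hXZ + 3 * k * Y * hAD + Y * hk - A ^ 2 * Y * (hX + hZ)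
  · linear_combination 3 * A * D * hXY + 3 * k * Z * hAD + Z * hk - A ^ 2 * Z * (hX + hY)


/-- Solutions of (S1) with nonzero off-diagonal parameters are symmetric. -/
lemma SystemS1.symmetric {A B C D E F X Y Z μ : ℝ} (hA : 0 < A) (hB : 0 < B) (hC : 0 < C)
    (hD : 0 < D) (hE : 0 < E) (hF : 0 < F) (h : SystemS1 A B C D E F X Y Z μ)
    (hXYZ : 0 < X * Y * Z) :
    (A = B ∧ A = C) ∧ (D = E ∧ D = F) ∧ Y ^ 2 = X ^ 2 ∧ Z ^ 2 = X ^ 2 := by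
  have hX : 0 < |X| := abs_pos.2 fun h => by simp [h] at hXYZ
  have hY : 0 < |Y| := abs_pos.2 fun h => by simp [h] at hXYZ
  have hZ : 0 < |Z| := abs_pos.2 fun h => by simp [h] at hXYZ
  have sq : ∀ x : ℝ, √(1 + x ^ 2) ^ 2 = 1 + |x| ^ 2 := fun x => by
    rw [Real.sq_sqrt (by positivity), sq_abs]
  have pos : ∀ x : ℝ, 0 < √(1 + x ^ 2) := fun x => Real.sqrt_pos.2 (by positivity)
  obtain ⟨⟨hu, hu'⟩, ⟨hw, hw'⟩, hc, hc'⟩ := ((h.abs hXYZ).polarSystem hA hB hC hD hE hF hX hY hZ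
    (pos X) (pos Y) (pos Z) (sq X) (sq Y) (sq Z)).all_eq
  have sX := sq X
  have sY := sq Y
  have sZ := sq Z
  rw [sq_abs] at sX sY sZ
  have hp := pos X
  rw [← inv_inj.1 hc', ← inv_inj.1 hc] at hu'
  rw [← inv_inj.1 hc', ← inv_inj.1 hc] at hu
  rw [← inv_inj.1 hc', ← inv_inj.1 hc] at hw'
  rw [← inv_inj.1 hc] at hw
  rw [← inv_inj.1 hc', ← inv_inj.1 hc] at sZ
  rw [← inv_inj.1 hc] at sY
  have eB := mul_right_cancel₀ (mul_pos hp hp).ne' hu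
  have eC := mul_right_cancel₀ (mul_pos hp hp).ne' hu'
  have eE := mul_right_cancel₀ hp.ne' hw
  have eF := mul_right_cancel₀ hp.ne' hw'
  exact ⟨⟨by linarith, by linarith⟩, ⟨by linarith, by linarith⟩, by linarith, by linarith⟩

/-- The off-diagonal parameters of a solution vanish together or have positive product. -/
lemma SystemS1.off_diagonal {A B C D E F X Y Z μ : ℝ} (hA : 0 < A) (hB : 0 < B) (hC : 0 < C)
    (hD : 0 < D) (hE : 0 < E) (hF : 0 < F) (h : SystemS1 A B C D E F X Y Z μ) :
    (X = 0 ∧ Y = 0 ∧ Z = 0) ∨ 0 < X * Y * Z := by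
  obtain ⟨-, -, -, -, -, -, -, hX', hY', hZ'⟩ := h
  have hS : 0 < A * D + B * E + C * F := by positivity
  have eX : X ^ 2 * ((B - C) ^ 2 + (B * Z) ^ 2 + (C * Y) ^ 2 + D ^ 2) =
      X * Y * Z * (A * D + B * E + C * F) := by linear_combination -X * hX'
  have eY : Y ^ 2 * ((A - C) ^ 2 + (C * X) ^ 2 + (A * Z) ^ 2 + E ^ 2) =
      X * Y * Z * (A * D + B * E + C * F) := by linear_combination -Y * hY'
  have eZ : Z ^ 2 * ((A - B) ^ 2 + (A * Y) ^ 2 + (B * X) ^ 2 + F ^ 2) =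
      X * Y * Z * (A * D + B * E + C * F) := by linear_combination -Z * hZ'
  have nonneg : 0 ≤ X * Y * Z :=
    nonneg_of_mul_nonneg_left (eX ▸ by positivity : 0 ≤ X * Y * Z * (A * D + B * E + C * F)) hS
  rcases nonneg.eq_or_lt with h0 | h0
  · left
    rw [← h0, zero_mul] at eX eY eZ
    exact ⟨pow_eq_zero_iff two_ne_zero |>.1 ((mul_eq_zero.1 eX).resolve_right (by positivity)),
      pow_eq_zero_iff two_ne_zero |>.1 ((mul_eq_zero.1 eY).resolve_right (by positivity)),
      pow_eq_zero_iff two_ne_zero |>.1 ((mul_eq_zero.1 eZ).resolve_right (by positivity))⟩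
  · exact Or.inr h0

/-- The symmetric case reduces to two equations in `A` and `x = X ^ 2`. -/
lemma SystemS1.symmetric_cases {A D X Y Z μ : ℝ} (hA : 0 < A) (hD : 0 < D)
    (h : SystemS1 A A A D D D X Y Z μ) (hXYZ : 0 < X * Y * Z) (hYX : Y ^ 2 = X ^ 2)
    (hZX : Z ^ 2 = X ^ 2) : A * D = 1 ∧
      ((X ^ 2 = 1 ∧ (A = 1 ∨ 2 * A ^ 2 = 1) ∧ X * Y * Z = 1 ∧ μ = -1) ∨
      (3 * X ^ 2 = 1 ∧ 4 * (A ^ 2) ^ 2 = 3 ∧ 27 * (X * Y * Z) ^ 2 = 1 ∧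
        μ = -5 * (X * Y * Z))) := by
  obtain ⟨vol, hA', -, -, hD', -, -, hX', -, -⟩ := h
  have hAD : A * D = 1 := by
    refine (pow_eq_one_iff_of_nonneg (by positivity) (by norm_num : 3 ≠ 0)).1 ?_
    linear_combination vol
  have eA : μ = A ^ 2 * (1 + X ^ 2) ^ 2 - 2 * A ^ 2 * (1 + X ^ 2) - X * Y * Z := by
    linear_combination A * hA' - μ * vol + (A ^ 2 * Z ^ 2) * hYX + (A ^ 2 * X ^ 2) * hZX
      - X * Y * Z * hAD
  have eD : μ = D ^ 2 * (1 + X ^ 2) - 2 * D ^ 2 - X * Y * Z := by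
    linear_combination D * hD' - μ * vol - X * Y * Z * hAD
  have eX : X ^ 2 * (2 * A ^ 2 * X ^ 2 + D ^ 2) = 3 * (X * Y * Z) := by
    linear_combination -X * hX' - A ^ 2 * X ^ 2 * (hYX + hZX) + 3 * X * Y * Z * hAD
  have ht : (X * Y * Z) ^ 2 = (X ^ 2) ^ 3 := by
    linear_combination X ^ 2 * Z ^ 2 * hYX + X ^ 4 * hZX
  refine ⟨hAD, ?_⟩
  generalize X * Y * Z = t at *
  generalize hx : X ^ 2 = x at *
  have hx0 : 0 ≤ x := hx ▸ sq_nonneg X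
  have split : (x - 1) * (A ^ 2 * (1 + x) - D ^ 2) = 0 := by linear_combination eD - eA
  rcases mul_eq_zero.1 split with h | h
  · left
    have hx1 : x = 1 := by linarith
    subst hx1
    have ht1 : t = 1 := (pow_eq_one_iff_of_nonneg hXYZ.le two_ne_zero).1 (by linarith)
    subst ht1
    refine ⟨rfl, ?_, rfl, by linarith⟩
    have : (A ^ 2 - 1) * (2 * A ^ 2 - 1) = 0 := by
      linear_combination A ^ 2 * eX - (A * D + 1) * hAD
    rcases mul_eq_zero.1 this with h | h
    · left
      exact (pow_eq_one_iff_of_nonneg hA.le two_ne_zero).1 (by linarith)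
    · right
      linarith
  · right
    have hA4 : (A ^ 2) ^ 2 * (1 + x) = 1 := by
      linear_combination A ^ 2 * h + (A * D + 1) * hAD
    have eX' : x * (A ^ 2 * (3 * x + 1)) = 3 * t := by linear_combination eX + x * h
    have hx2 : 0 < x := by
      rcases hx0.eq_or_lt with h0 | h0
      · rw [← h0] at ht
        nlinarith
      · exact h0
    have hx3 : 3 * x = 1 := by
      have : x ^ 2 * ((3 * x + 1) ^ 2 - 9 * x * (1 + x)) = 0 := by
        linear_combination (1 + x) * (x * (A ^ 2 * (3 * x + 1)) + 3 * t) * eX'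
          + 9 * (1 + x) * ht - x ^ 2 * (3 * x + 1) ^ 2 * hA4
      have := (mul_eq_zero.1 this).resolve_left (by positivity)
      linarith
    have hx4 : x = 1 / 3 := by linarith
    subst hx4
    refine ⟨hx3, by linarith, by linarith, by linarith⟩

lemma eq_or_eq_of_sq_eq {x a : ℝ} (h : x ^ 2 = a ^ 2) : x = -a ∨ x = a :=
  (sq_eq_sq_iff_eq_or_eq_neg.1 h).symm

/-- Classification of the solutions of (S1) with positive `A,…,F`. -/
theorem systemS1_solutions (A B C D E F X Y Z μ : ℝ) :
    (0 < A ∧ 0 < B ∧ 0 < C ∧ 0 < D ∧ 0 < E ∧ 0 < F ∧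
      SystemS1 A B C D E F X Y Z μ) ↔
    ((A = 1 ∧ B = 1 ∧ C = 1 ∧ D = 1 ∧ E = 1 ∧ F = 1 ∧
        X = 0 ∧ Y = 0 ∧ Z = 0 ∧ μ = -1) ∨
     (A = 1 ∧ B = 1 ∧ C = 1 ∧ D = 1 ∧ E = 1 ∧ F = 1 ∧
        (X = -1 ∨ X = 1) ∧ (Y = -1 ∨ Y = 1) ∧ (Z = -1 ∨ Z = 1) ∧
        X*Y*Z = 1 ∧ μ = -1) ∨
     (A = (Real.sqrt 2)⁻¹ ∧ B = (Real.sqrt 2)⁻¹ ∧ C = (Real.sqrt 2)⁻¹ ∧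
        D = Real.sqrt 2 ∧ E = Real.sqrt 2 ∧ F = Real.sqrt 2 ∧
        (X = -1 ∨ X = 1) ∧ (Y = -1 ∨ Y = 1) ∧ (Z = -1 ∨ Z = 1) ∧
        X*Y*Z = 1 ∧ μ = -1) ∨
     (A = Real.sqrt (Real.sqrt 3) / Real.sqrt 2 ∧
        B = Real.sqrt (Real.sqrt 3) / Real.sqrt 2 ∧
        C = Real.sqrt (Real.sqrt 3) / Real.sqrt 2 ∧
        D = Real.sqrt 2 / Real.sqrt (Real.sqrt 3) ∧
        E = Real.sqrt 2 / Real.sqrt (Real.sqrt 3) ∧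
        F = Real.sqrt 2 / Real.sqrt (Real.sqrt 3) ∧
        (X = -(Real.sqrt 3)⁻¹ ∨ X = (Real.sqrt 3)⁻¹) ∧
        (Y = -(Real.sqrt 3)⁻¹ ∨ Y = (Real.sqrt 3)⁻¹) ∧
        (Z = -(Real.sqrt 3)⁻¹ ∨ Z = (Real.sqrt 3)⁻¹) ∧
        X*Y*Z = 1/(3*Real.sqrt 3) ∧ μ = -5/(3*Real.sqrt 3))) := by
  constructor
  · rintro ⟨hA, hB, hC, hD, hE, hF, h⟩
    rcases h.off_diagonal hA hB hC hD hE hF with ⟨rfl, rfl, rfl⟩ | hXYZ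
    · left
      obtain ⟨vol, hA', hB', hC', hD', hE', hF', -⟩ := h
      obtain ⟨rfl, rfl⟩ := eq_of_decoupled hA hB hC (μ := μ)
        (by linear_combination A * hA' - μ * vol) (by linear_combination B * hB' - μ * vol)
        (by linear_combination C * hC' - μ * vol)
      obtain ⟨rfl, rfl⟩ := eq_of_decoupled hD hE hF (μ := μ)
        (by linear_combination D * hD' - μ * vol) (by linear_combination E * hE' - μ * vol)
        (by linear_combination F * hF' - μ * vol)
      have hsq : A ^ 2 = D ^ 2 := by
        linear_combination A * hA' - D * hD'
      obtain rfl : A = D := (pow_left_inj₀ hA.le hD.le two_ne_zero).1 hsq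
      obtain rfl : A = 1 :=
        (pow_eq_one_iff_of_nonneg hA.le (by norm_num : 6 ≠ 0)).1 (by linear_combination vol)
      exact ⟨rfl, rfl, rfl, rfl, rfl, rfl, rfl, rfl, rfl, by linarith⟩
    · right
      obtain ⟨⟨rfl, rfl⟩, ⟨rfl, rfl⟩, hYX, hZX⟩ := h.symmetric hA hB hC hD hE hF hXYZ
      obtain ⟨hAD, ⟨hX, hA', ht, hμ⟩ | ⟨hX, hA', ht, hμ⟩⟩ :=
        h.symmetric_cases hA hD hXYZ hYX hZX
      · have hX1 : X = -1 ∨ X = 1 := eq_or_eq_of_sq_eq (by linarith)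
        have hY1 : Y = -1 ∨ Y = 1 := eq_or_eq_of_sq_eq (by linarith)
        have hZ1 : Z = -1 ∨ Z = 1 := eq_or_eq_of_sq_eq (by linarith)
        rcases hA' with rfl | hA'
        · left
          obtain rfl : D = 1 := by linarith
          exact ⟨rfl, rfl, rfl, rfl, rfl, rfl, hX1, hY1, hZ1, ht, hμ⟩
        · right; left
          have hDA : D = 2 * A := by linear_combination (-D) * hA' + 2 * A * hAD
          have hD2 : D = √2 := by
            rw [eq_comm, Real.sqrt_eq_iff_mul_self_eq_of_pos hD, hDA]
            linear_combination 2 * hA'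
          have hA2 : A = (√2)⁻¹ := by
            rw [← hD2]; exact eq_inv_of_mul_eq_one_left hAD
          exact ⟨hA2, hA2, hA2, hD2, hD2, hD2, hX1, hY1, hZ1, ht, hμ⟩
      · right; right
        have h2 : √2 ^ 2 = 2 := Real.sq_sqrt (by norm_num)
        have h3 : √3 ^ 2 = 3 := Real.sq_sqrt (by norm_num)
        have h33 : √√3 ^ 2 = √3 := Real.sq_sqrt (by positivity)
        have p2 : 0 < √2 := by positivity
        have p3 : 0 < √3 := by positivity
        have p33 : 0 < √√3 := by positivity
        have hinv : ((√3)⁻¹) ^ 2 = 1 / 3 := by rw [inv_pow, h3, one_div]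
        have hX1 := eq_or_eq_of_sq_eq (x := X) (a := (√3)⁻¹) (by linarith)
        have hY1 := eq_or_eq_of_sq_eq (x := Y) (a := (√3)⁻¹) (by linarith)
        have hZ1 := eq_or_eq_of_sq_eq (x := Z) (a := (√3)⁻¹) (by linarith)
        have ht1 : X * Y * Z = 1 / (3 * √3) := by
          refine (pow_left_inj₀ hXYZ.le (by positivity) two_ne_zero).1 ?_
          rw [div_pow, mul_pow (3 : ℝ), h3]
          linarith
        have hA2 : 2 * A ^ 2 = √3 := by
          refine (pow_left_inj₀ (by positivity) p3.le two_ne_zero).1 ?_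
          rw [h3]
          linarith
        have hA3 : A = √√3 / √2 := by
          refine (pow_left_inj₀ hA.le (by positivity) two_ne_zero).1 ?_
          rw [div_pow, h33, h2]
          linarith
        have hD3 : D = √2 / √√3 := by
          rw [← inv_div, ← hA3]; exact eq_inv_of_mul_eq_one_right hAD
        refine ⟨hA3, hA3, hA3, hD3, hD3, hD3, hX1, hY1, hZ1, ht1, ?_⟩
        rw [hμ, ht1]
        ring
  · have sq_of : ∀ {x a : ℝ}, (x = -a ∨ x = a) → x ^ 2 = a ^ 2 := by
      rintro x a (rfl | rfl) <;> ring
    rintro (⟨rfl, rfl, rfl, rfl, rfl, rfl, rfl, rfl, rfl, rfl⟩ |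
      ⟨rfl, rfl, rfl, rfl, rfl, rfl, hX, hY, hZ, ht, rfl⟩ |
      ⟨rfl, rfl, rfl, rfl, rfl, rfl, hX, hY, hZ, ht, rfl⟩ |
      ⟨rfl, rfl, rfl, rfl, rfl, rfl, hX, hY, hZ, ht, rfl⟩)
    · refine ⟨one_pos, one_pos, one_pos, one_pos, one_pos, one_pos, ?_⟩
      norm_num [SystemS1]
    · refine ⟨one_pos, one_pos, one_pos, one_pos, one_pos, one_pos, ?_⟩
      have sX := sq_of hX
      have sY := sq_of hY
      have sZ := sq_of hZ
      apply systemS1_of_symmetric (x := 1) (k := 1)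
      · norm_num
      · linarith
      · linarith
      · linarith
      · linear_combination X * ht - Y * Z * sX
      · linear_combination Y * ht - X * Z * sY
      · linear_combination Z * ht - X * Y * sZ
      all_goals norm_num
    · have p2 : 0 < √2 := by positivity
      refine ⟨by positivity, by positivity, by positivity, p2, p2, p2, ?_⟩
      have h2 : √2 ^ 2 = 2 := Real.sq_sqrt (by norm_num)
      have sX := sq_of hX
      have sY := sq_of hY
      have sZ := sq_of hZ
      apply systemS1_of_symmetric (x := 1) (k := 1)
      · exact inv_mul_cancel₀ p2.ne'
      · linarith
      · linarith
      · linarith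
      · linear_combination X * ht - Y * Z * sX
      · linear_combination Y * ht - X * Z * sY
      · linear_combination Z * ht - X * Y * sZ
      · field_simp; linarith
      · field_simp; linarith
      · rw [inv_pow, h2]; norm_num
    · have p2 : 0 < √2 := by positivity
      have p3 : 0 < √3 := by positivity
      have p33 : 0 < √√3 := by positivity
      refine ⟨by positivity, by positivity, by positivity, by positivity, by positivity,
        by positivity, ?_⟩
      have h2 : √2 ^ 2 = 2 := Real.sq_sqrt (by norm_num)
      have h3 : √3 ^ 2 = 3 := Real.sq_sqrt (by norm_num)
      have h33 : √√3 ^ 2 = √3 := Real.sq_sqrt (by positivity)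
      have hinv : ((√3)⁻¹) ^ 2 = 1 / 3 := by rw [inv_pow, h3, one_div]
      have ht' : 3 * (X * Y * Z) = (√3)⁻¹ := by rw [ht]; field_simp
      have sX := sq_of hX
      have sY := sq_of hY
      have sZ := sq_of hZ
      rw [hinv] at sX sY sZ
      apply systemS1_of_symmetric (x := 1 / 3) (k := (√3)⁻¹)
      · field_simp
      · exact sX
      · exact sY
      · exact sZ
      · linear_combination X * ht' - 3 * Y * Z * sX
      · linear_combination Y * ht' - 3 * X * Z * sY
      · linear_combination Z * ht' - 3 * X * Y * sZ
      · field_simp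
        rw [h33, h2]; nlinarith
      · field_simp
        rw [h33, h2]; nlinarith
      · rw [div_pow, div_pow, h33, h2]
        field_simp
        linarith
end

section
/- Every solution (A,B,C,D,E,F,X,Y,Z,μ) ∈ ℝ¹⁰ of the system (S1) with A,B,C,D,E,F > 0 satisfies μ = −1 or μ = −5/(3√3). Equivalently, every left-invariant Einstein metric of unit volume on S³×S³ that is invariant under a ℤ₂×ℤ₂ subgroup of inner automorphisms has scalar curvature S = −3μ equal to 3 or to 5/√3. -/
/-- The reduced Einstein system: `x`, `y`, `z` stand for `X²`, `Y²`, `Z²`, `t` for `XYZ` and `m`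
for `-μ`. -/
structure ReducedSol (A B C D E F x y z t m : ℝ) : Prop where
  hA : 0 < A
  hB : 0 < B
  hC : 0 < C
  hD : 0 < D
  hE : 0 < E
  hF : 0 < F
  hx : 0 < x
  hy : 0 < y
  hz : 0 < z
  ht : 0 < t
  sq : t ^ 2 = x * y * z
  eqA : A*D*t + A*B*(1+z) + A*C*(1+y) - A^2*(1+y)*(1+z) = m
  eqB : B*E*t + A*B*(1+z) + B*C*(1+x) - B^2*(1+x)*(1+z) = m
  eqC : C*F*t + A*C*(1+y) + B*C*(1+x) - C^2*(1+x)*(1+y) = m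
  eqD : A*D*t + D*E + D*F - D^2*(1+x) = m
  eqE : B*E*t + D*E + E*F - E^2*(1+y) = m
  eqF : C*F*t + D*F + E*F - F^2*(1+z) = m
  eqX : x*((B-C)^2 + B^2*z + C^2*y + D^2) = (A*D + B*E + C*F)*t
  eqY : y*((A-C)^2 + A^2*z + C^2*x + E^2) = (A*D + B*E + C*F)*t
  eqZ : z*((A-B)^2 + A^2*y + B^2*x + F^2) = (A*D + B*E + C*F)*t

namespace ReducedSol

variable {A B C D E F x y z t m : ℝ}

theorem swap12 (h : ReducedSol A B C D E F x y z t m) : ReducedSol B A C E D F y x z t m := by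
  obtain ⟨hA, hB, hC, hD, hE, hF, hx, hy, hz, ht, sq, eA, eB, eC, eD, eE, eF, eX, eY, eZ⟩ := h
  constructor <;> first | assumption | linarith

theorem swap23 (h : ReducedSol A B C D E F x y z t m) : ReducedSol A C B D F E x z y t m := by
  obtain ⟨hA, hB, hC, hD, hE, hF, hx, hy, hz, ht, sq, eA, eB, eC, eD, eE, eF, eX, eY, eZ⟩ := h
  constructor <;> first | assumption | linarith

/-- Sum of two of the off-diagonal equations, as an identity between squares. -/
theorem two_mul_gap (h : ReducedSol A B C D E F x y z t m) :
    2 * (A * (D*t - A*y*z)) =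
      (E*y - B*t)^2 / y + (F*z - C*t)^2 / z + y*(A-C)^2 + z*(A-B)^2 := by
  have hy := h.hy
  have hz := h.hz
  have h1 : (E*y - B*t)^2 / y = E^2*y - 2*B*E*t + B^2*x*z := by
    rw [div_eq_iff hy.ne']
    linear_combination B^2 * h.sq
  have h2 : (F*z - C*t)^2 / z = F^2*z - 2*C*F*t + C^2*x*y := by
    rw [div_eq_iff hz.ne']
    linear_combination C^2 * h.sq
  rw [h1, h2]
  linear_combination -h.eqY - h.eqZ

theorem gap_nonneg (h : ReducedSol A B C D E F x y z t m) : A*y*z ≤ D*t := by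
  have hA := h.hA
  have hy := h.hy
  have hz := h.hz
  have key : 0 ≤ 2 * (A * (D*t - A*y*z)) := by
    rw [h.two_mul_gap]
    positivity
  have := nonneg_of_mul_nonneg_right (by linarith : 0 ≤ A * (D*t - A*y*z)) hA
  linarith

theorem gap_pos (h : ReducedSol A B C D E F x y z t m) (hne : ¬ (A = B ∧ B = C)) :
    A*y*z < D*t := by
  have hA := h.hA
  have hy := h.hy
  have hz := h.hz
  refine lt_of_le_of_ne h.gap_nonneg fun h0 => hne ?_
  have key := h.two_mul_gap
  rw [h0, sub_self, mul_zero, mul_zero] at key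
  have i1 : 0 ≤ (E*y - B*t)^2 / y := by positivity
  have i2 : 0 ≤ (F*z - C*t)^2 / z := by positivity
  have i3 : 0 ≤ y*(A-C)^2 := by positivity
  have i4 : 0 ≤ z*(A-B)^2 := by positivity
  have j3 : y*(A-C)^2 = 0 := by linarith
  have j4 : z*(A-B)^2 = 0 := by linarith
  have k3 : A - C = 0 := by simpa [hy.ne'] using j3
  have k4 : A - B = 0 := by simpa [hz.ne'] using j4
  constructor <;> linarith

theorem t_mul_twist (h : ReducedSol A B C D E F x y z t m) :
    t * (D*x - A*t) = x * (D*t - A*y*z) := by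
  linear_combination -A * h.sq

theorem twist_nonneg (h : ReducedSol A B C D E F x y z t m) : A*t ≤ D*x := by
  have := nonneg_of_mul_nonneg_right (a := t) (b := D*x - A*t)
    (h.t_mul_twist ▸ mul_nonneg h.hx.le (sub_nonneg.2 h.gap_nonneg)) h.ht
  linarith

theorem twist_pos (h : ReducedSol A B C D E F x y z t m) (hne : ¬ (A = B ∧ B = C)) :
    A*t < D*x := by
  have := (mul_pos_iff_of_pos_left h.ht).1
    (h.t_mul_twist ▸ mul_pos h.hx (sub_pos.2 (h.gap_pos hne)))
  linarith

theorem m_pos_of_min (h : ReducedSol A B C D E F x y z t m) (hAB : A ≤ B) (hAC : A ≤ C) :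
    0 < m := by
  have e : m = A*(B-A)*(1+z) + A*(C-A)*(1+y) + A^2 + A*(D*t - A*y*z) := by
    linear_combination -h.eqA
  have i1 : 0 ≤ A*(B-A)*(1+z) :=
    mul_nonneg (mul_nonneg h.hA.le (sub_nonneg.2 hAB)) (by linarith [h.hz])
  have i2 : 0 ≤ A*(C-A)*(1+y) :=
    mul_nonneg (mul_nonneg h.hA.le (sub_nonneg.2 hAC)) (by linarith [h.hy])
  have i3 : 0 ≤ A*(D*t - A*y*z) := mul_nonneg h.hA.le (sub_nonneg.2 h.gap_nonneg)
  have i4 : 0 < A^2 := pow_pos h.hA 2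
  linarith

theorem m_pos (h : ReducedSol A B C D E F x y z t m) : 0 < m := by
  rcases le_total A B with h1 | h1 <;> rcases le_total A C with h2 | h2 <;>
    rcases le_total B C with h3 | h3
  · exact h.m_pos_of_min h1 h2
  · exact h.m_pos_of_min h1 h2
  · exact h.m_pos_of_min h1 (h1.trans h3)
  · exact h.swap23.swap12.m_pos_of_min h2 h3
  · exact h.swap12.m_pos_of_min h1 h3
  · exact h.swap23.swap12.m_pos_of_min (h3.trans h1) h3
  · exact h.swap12.m_pos_of_min h1 h3
  · exact h.swap23.swap12.m_pos_of_min h2 h3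

theorem triangle (h : ReducedSol A B C D E F x y z t m) : D < E + F := by
  have e : D * (E + F - D) = m + D*(D*x - A*t) := by linear_combination h.eqD
  have : 0 < D * (E + F - D) := by
    rw [e]
    linarith [h.m_pos, mul_nonneg h.hD.le (sub_nonneg.2 h.twist_nonneg)]
  linarith [(mul_pos_iff_of_pos_left h.hD).1 this]

theorem m_lt_of_max (h : ReducedSol A B C D E F x y z t m) (hne : ¬ (A = B ∧ B = C))
    (hE : E ≤ D) (hF : F ≤ D) : m < E*F ∧ m < D*F ∧ m < D*E := by
  have e : E*F = m + D*(D*x - A*t) + (D-E)*(D-F) := by linear_combination h.eqD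
  have i1 : 0 < D*(D*x - A*t) := mul_pos h.hD (sub_pos.2 (h.twist_pos hne))
  have i2 : 0 ≤ (D-E)*(D-F) := mul_nonneg (sub_nonneg.2 hE) (sub_nonneg.2 hF)
  have i3 : m < E*F := by linarith
  exact ⟨i3, i3.trans_le (mul_le_mul_of_nonneg_right hE h.hF.le),
    i3.trans_le (by nlinarith [h.hE])⟩

theorem m_lt (h : ReducedSol A B C D E F x y z t m) (hne : ¬ (A = B ∧ B = C)) :
    m < E*F ∧ m < D*F ∧ m < D*E := by
  have n2 : ¬ (B = A ∧ A = C) := fun h => hne ⟨h.1.symm, h.1.trans h.2⟩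
  have n3 : ¬ (C = A ∧ A = B) := fun h => hne ⟨h.2, h.2.symm.trans h.1.symm⟩
  have h2 := h.swap12.m_lt_of_max n2
  have h3 := h.swap23.swap12.m_lt_of_max n3
  rw [mul_comm E D] at h2
  rw [mul_comm F E, mul_comm F D] at h3
  rcases le_total E D with d1 | d1 <;> rcases le_total F D with d2 | d2
  · exact h.m_lt_of_max hne d1 d2
  · obtain ⟨p, q, r⟩ := h3 d2 (d1.trans d2)
    exact ⟨q, r, p⟩
  · obtain ⟨p, q, r⟩ := h2 d1 (d2.trans d1)
    exact ⟨q, p, r⟩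
  · rcases le_total E F with d3 | d3
    · obtain ⟨p, q, r⟩ := h3 d2 d3
      exact ⟨q, r, p⟩
    · obtain ⟨p, q, r⟩ := h2 d1 d3
      exact ⟨q, p, r⟩

/-- Comparison of two blocks: `D - F` is governed by `A - C`. -/
theorem compare13 (h : ReducedSol A B C D E F x y z t m) :
    (D-F)*(D+F-E) = (A-C)*(A+C-B) + z*(B*(A-B)) + y*(A^2-C^2) + x*(B*(B-C)) := by
  linear_combination h.eqF - h.eqD + h.eqA - h.eqC - h.eqX + h.eqZ

theorem weight (h : ReducedSol A B C D E F x y z t m) :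
    x * (A*C*(1+y) + D*F + A*B*(1+z) + D*E - 3*m) = (A*D + B*E + C*F)*t := by
  linear_combination h.eqX + x*(h.eqB + h.eqC + h.eqD + h.eqX)

end ReducedSol

/-- Two solutions of the reduced system related by the involution that exchanges the two
blocks `(A, B, C)` and `(D, E, F)` up to rescaling. -/
structure DualPair (A B C D E F P Q R U V W x y z t m : ℝ) : Prop where
  left : ReducedSol A B C D E F x y z t m
  right : ReducedSol P Q R U V W x y z t m
  PU : P*U = A*D
  QV : Q*V = B*E
  RW : R*W = C*F
  UV : U*V = A*B*(1+z)
  UW : U*W = A*C*(1+y)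
  VW : V*W = B*C*(1+x)
  DE : D*E = P*Q*(1+z)
  DF : D*F = P*R*(1+y)
  EF : E*F = Q*R*(1+x)

/-- Every solution of the reduced system has a dual solution. -/
theorem ReducedSol.exists_dualPair {A B C D E F x y z t m : ℝ}
    (h : ReducedSol A B C D E F x y z t m) :
    ∃ P Q R U V W : ℝ, DualPair A B C D E F P Q R U V W x y z t m := by
  obtain ⟨hA, hB, hC, hD, hE, hF, hx, hy, hz, ht, sq, eA, eB, eC, eD, eE, eF, eX, eY, eZ⟩ := id h
  obtain ⟨p, hp, ep⟩ : ∃ p : ℝ, 0 < p ∧ p^2 = 1 + x :=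
    ⟨√(1+x), by positivity, Real.sq_sqrt (by positivity)⟩
  obtain ⟨q, hq, eq⟩ : ∃ q : ℝ, 0 < q ∧ q^2 = 1 + y :=
    ⟨√(1+y), by positivity, Real.sq_sqrt (by positivity)⟩
  obtain ⟨r, hr, er⟩ : ∃ r : ℝ, 0 < r ∧ r^2 = 1 + z :=
    ⟨√(1+z), by positivity, Real.sq_sqrt (by positivity)⟩
  obtain ⟨P, hP, eP⟩ : ∃ P : ℝ, 0 < P ∧ P*(q*r) = D*p := ⟨D*p/(q*r), by positivity, by field_simp⟩
  obtain ⟨Q, hQ, eQ⟩ : ∃ Q : ℝ, 0 < Q ∧ Q*(p*r) = E*q := ⟨E*q/(p*r), by positivity, by field_simp⟩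
  obtain ⟨R, hR, eR⟩ : ∃ R : ℝ, 0 < R ∧ R*(p*q) = F*r := ⟨F*r/(p*q), by positivity, by field_simp⟩
  obtain ⟨U, hU, eU⟩ : ∃ U : ℝ, 0 < U ∧ U*p = A*(q*r) := ⟨A*(q*r)/p, by positivity, by field_simp⟩
  obtain ⟨V, hV, eV⟩ : ∃ V : ℝ, 0 < V ∧ V*q = B*(p*r) := ⟨B*(p*r)/q, by positivity, by field_simp⟩
  obtain ⟨W, hW, eW⟩ : ∃ W : ℝ, 0 < W ∧ W*r = C*(p*q) := ⟨C*(p*q)/r, by positivity, by field_simp⟩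
  have PU : P*U = A*D := by
    refine mul_right_cancel₀ (b := p*q*r) (by positivity) ?_
    linear_combination U*p*eP + D*p*eU
  have QV : Q*V = B*E := by
    refine mul_right_cancel₀ (b := p*q*r) (by positivity) ?_
    linear_combination V*q*eQ + E*q*eV
  have RW : R*W = C*F := by
    refine mul_right_cancel₀ (b := p*q*r) (by positivity) ?_
    linear_combination W*r*eR + F*r*eW
  have UV : U*V = A*B*(1+z) := by
    refine mul_right_cancel₀ (b := p*q) (by positivity) ?_
    linear_combination V*q*eU + A*q*r*eV + A*B*p*q*er
  have UW : U*W = A*C*(1+y) := by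
    refine mul_right_cancel₀ (b := p*r) (by positivity) ?_
    linear_combination W*r*eU + A*q*r*eW + A*C*p*r*eq
  have VW : V*W = B*C*(1+x) := by
    refine mul_right_cancel₀ (b := q*r) (by positivity) ?_
    linear_combination W*r*eV + B*p*r*eW + B*C*q*r*ep
  have DE : D*E = P*Q*(1+z) := by
    refine mul_right_cancel₀ (b := p*q) (by positivity) ?_
    linear_combination -Q*p*r*eP - D*p*eQ + P*Q*p*q*er
  have DF : D*F = P*R*(1+y) := by
    refine mul_right_cancel₀ (b := p*r) (by positivity) ?_
    linear_combination -R*p*q*eP - D*p*eR + P*R*p*r*eq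
  have EF : E*F = Q*R*(1+x) := by
    refine mul_right_cancel₀ (b := q*r) (by positivity) ?_
    linear_combination -R*p*q*eQ - E*q*eR + Q*R*q*r*ep
  have UU : U^2*(1+x) = A^2*(1+y)*(1+z) := by
    rw [← ep, ← eq, ← er]
    linear_combination (U*p + A*(q*r))*eU
  have VV : V^2*(1+y) = B^2*(1+x)*(1+z) := by
    rw [← ep, ← eq, ← er]
    linear_combination (V*q + B*(p*r))*eV
  have WW : W^2*(1+z) = C^2*(1+x)*(1+y) := by
    rw [← ep, ← eq, ← er]
    linear_combination (W*r + C*(p*q))*eW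
  have PP : P^2*(1+y)*(1+z) = D^2*(1+x) := by
    rw [← ep, ← eq, ← er]
    linear_combination (P*(q*r) + D*p)*eP
  have QQ : Q^2*(1+x)*(1+z) = E^2*(1+y) := by
    rw [← ep, ← eq, ← er]
    linear_combination (Q*(p*r) + E*q)*eQ
  have RR : R^2*(1+x)*(1+y) = F^2*(1+z) := by
    rw [← ep, ← eq, ← er]
    linear_combination (R*(p*q) + F*r)*eR
  refine ⟨P, Q, R, U, V, W, h, ⟨hP, hQ, hR, hU, hV, hW, hx, hy, hz, ht, sq, ?_, ?_, ?_, ?_, ?_, ?_,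
    ?_, ?_, ?_⟩, PU, QV, RW, UV, UW, VW, DE, DF, EF⟩
  · linear_combination t*PU - DE - DF - PP + eD
  · linear_combination t*QV - DE - EF - QQ + eE
  · linear_combination t*RW - DF - EF - RR + eF
  · linear_combination t*PU + UV + UW - UU + eA
  · linear_combination t*QV + UV + VW - VV + eB
  · linear_combination t*RW + UW + VW - WW + eC
  · refine mul_right_cancel₀ (b := 1+x) (by positivity) ?_
    linear_combination x*(QQ + RR + UU + 2*EF) - t*(1+x)*(PU + QV + RW) + eX
      + x*(eB + eC + eD - eA - eE - eF + eX)
  · refine mul_right_cancel₀ (b := 1+y) (by positivity) ?_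
    linear_combination y*(PP + RR + VV + 2*DF) - t*(1+y)*(PU + QV + RW) + eY
      + y*(eA + eC + eE - eB - eD - eF + eY)
  · refine mul_right_cancel₀ (b := 1+z) (by positivity) ?_
    linear_combination z*(PP + QQ + WW + 2*DE) - t*(1+z)*(PU + QV + RW) + eZ
      + z*(eA + eB + eF - eC - eD - eE + eZ)

namespace DualPair

variable {A B C D E F P Q R U V W x y z t m : ℝ}

theorem symm (h : DualPair A B C D E F P Q R U V W x y z t m) :
    DualPair P Q R U V W A B C D E F x y z t m :=
  ⟨h.right, h.left, h.PU.symm, h.QV.symm, h.RW.symm, h.DE, h.DF, h.EF, h.UV, h.UW, h.VW⟩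

theorem swap12 (h : DualPair A B C D E F P Q R U V W x y z t m) :
    DualPair B A C E D F Q P R V U W y x z t m := by
  refine ⟨h.left.swap12, h.right.swap12, h.QV, h.PU, h.RW, ?_, h.VW, h.UW, ?_, h.EF, h.DF⟩
  · linear_combination h.UV
  · linear_combination h.DE

theorem swap23 (h : DualPair A B C D E F P Q R U V W x y z t m) :
    DualPair A C B D F E P R Q U W V x z y t m := by
  refine ⟨h.left.swap23, h.right.swap23, h.PU, h.RW, h.QV, h.UW, h.UV, ?_, h.DF, h.DE, ?_⟩
  · linear_combination h.VW
  · linear_combination h.EF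

theorem weight_mul (h : DualPair A B C D E F P Q R U V W x y z t m) :
    x * (U*W + D*F + U*V + D*E - 3*m) = (A*D + B*E + C*F)*t := by
  rw [h.UW, h.UV]
  exact h.left.weight

theorem lt_iff_weight (h : DualPair A B C D E F P Q R U V W x y z t m) :
    x < z ↔ V*W + E*F < U*V + D*E := by
  obtain ⟨hA, hB, hC, hD, hE, hF, hx, hy, hz, ht, -⟩ := h.left
  have w1 := h.weight_mul
  have w3 := h.swap23.swap12.weight_mul
  have hpos : 0 < (A*D + B*E + C*F)*t := by positivity
  have p1 : 0 < U*W + D*F + U*V + D*E - 3*m := (mul_pos_iff_of_pos_left hx).1 (w1 ▸ hpos)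
  have p3 : 0 < W*V + F*E + W*U + F*D - 3*m :=
    (mul_pos_iff_of_pos_left hz).1 (by rw [w3]; linarith)
  have e : x * (U*W + D*F + U*V + D*E - 3*m) = z * (W*V + F*E + W*U + F*D - 3*m) := by
    rw [w1, w3]
    ring
  constructor
  · intro hlt
    by_contra! hle
    have i1 := mul_le_mul_of_nonneg_left hle hx.le
    have i2 := mul_lt_mul_of_pos_right hlt p3
    linarith
  · intro hlt
    by_contra! hle
    have i1 := mul_lt_mul_of_pos_left hlt hz
    have i2 := mul_le_mul_of_nonneg_right hle p1.le
    linarith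

/-- The largest and the smallest of `A`, `B`, `C` determine the order of the other unknowns. -/
theorem extremes (h : DualPair A B C D E F P Q R U V W x y z t m) (hBA : B ≤ A) (hCB : C ≤ B)
    (hCA : C < A) : F < D ∧ W < U ∧ D*W < U*F ∧ x < z := by
  obtain ⟨hA, hB, hC, hD, hE, hF, hx, hy, hz, ht, -⟩ := id h.left
  have hU := h.right.hD
  have hV := h.right.hE
  have hne : ¬ (A = B ∧ B = C) := fun e => hCA.ne' (e.1.trans e.2)
  obtain ⟨m1, m2, m3⟩ := h.left.m_lt hne
  have hFD : F < D := by
    have tri := h.left.swap12.triangle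
    have i1 : 0 < (A-C)*(A+C-B) := mul_pos (by linarith) (by linarith)
    have i2 : 0 ≤ z*(B*(A-B)) := mul_nonneg hz.le (mul_nonneg hB.le (by linarith))
    have i3 : 0 ≤ y*(A^2-C^2) :=
      mul_nonneg hy.le (sub_nonneg.2 (pow_le_pow_left₀ hC.le hCA.le 2))
    have i4 : 0 ≤ x*(B*(B-C)) := mul_nonneg hx.le (mul_nonneg hB.le (by linarith))
    have := (pos_iff_pos_of_mul_pos (by rw [h.left.compare13]; linarith :
      0 < (D-F)*(D+F-E))).2 (by linarith)
    linarith
  have hDW : D*W < U*F := by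
    have e : C*F*(D*F + D*E - m) - A*D*(E*F + D*F - m) = D*F*(C*D*(1+x) - A*F*(1+z)) := by
      linear_combination C*F*h.left.eqD - A*D*h.left.eqF
    have k : F*(D*F + D*E - m) < D*(E*F + D*F - m) := by
      have : 0 < (D-F)*(D*F-m) := mul_pos (by linarith) (by linarith)
      linarith
    have pos : 0 < D*(E*F + D*F - m) := by
      refine mul_pos hD ?_
      have := mul_pos hE hF
      linarith
    have lhs : C*F*(D*F + D*E - m) - A*D*(E*F + D*F - m) < 0 := by
      have i1 := mul_lt_mul_of_pos_left k hC
      have i2 := mul_lt_mul_of_pos_right hCA pos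
      linarith
    have cmp : C*D*(1+x) < A*F*(1+z) := by
      rw [e] at lhs
      by_contra! hle
      have : 0 ≤ D*F*(C*D*(1+x) - A*F*(1+z)) :=
        mul_nonneg (mul_pos hD hF).le (sub_nonneg.2 hle)
      linarith
    have cmpB := mul_lt_mul_of_pos_left cmp hB
    refine lt_of_mul_lt_mul_left (a := V) ?_ hV.le
    linear_combination cmpB + D*h.VW - F*h.UV
  have hWU : W < U := by
    refine lt_of_mul_lt_mul_left (a := D) ?_ hD.le
    linarith [mul_lt_mul_of_pos_left hFD hU]
  refine ⟨hFD, hWU, hDW, h.lt_iff_weight.2 ?_⟩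
  linarith [mul_lt_mul_of_pos_left hWU hV, mul_lt_mul_of_pos_left hFD hE]

theorem lt_one_add_mul (h : DualPair A B C D E F P Q R U V W x y z t m) :
    A < (1+x)*(B+C) := by
  obtain ⟨hA, hB, hC, hD, hE, hF, hx, hy, hz, ht, -⟩ := h.left
  have tri := h.right.triangle
  have hU := h.right.hD
  have e : U^2*(1+x) = A^2*(1+y)*(1+z) := by
    refine mul_right_cancel₀ (b := B*C) (by positivity) ?_
    linear_combination -U^2*h.VW + U*W*h.UV + A*B*(1+z)*h.UW
  have i : A*(A*(1+y)*(1+z)) < A*((1+x)*(B*(1+z) + C*(1+y))) := by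
    have := mul_lt_mul_of_pos_left tri (mul_pos hU (by linarith : 0 < 1+x))
    linear_combination this - e + (1+x)*(h.UV + h.UW)
  have j := lt_of_mul_lt_mul_left i hA.le
  have k : (1+x)*(B*(1+z) + C*(1+y)) ≤ ((1+x)*(B+C))*((1+y)*(1+z)) := by
    have : 0 ≤ (1+x)*(B*(y*(1+z)) + C*(z*(1+y))) := by positivity
    linarith
  refine lt_of_mul_lt_mul_right (a := (1+y)*(1+z)) ?_ (by positivity)
  linarith

theorem le_of_le (h : DualPair A B C D E F P Q R U V W x y z t m) (hBA : B ≤ A) (hCB : C ≤ B)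
    (hzy : z ≤ y) : F ≤ E := by
  obtain ⟨hA, hB, hC, hD, hE, hF, hx, hy, hz, ht, -⟩ := id h.left
  have tri := h.left.triangle
  have cmp := h.left.swap12.compare13
  have i1 : 0 ≤ (B-C)*((1+x)*(B+C) - A + y*A) := by
    have := h.lt_one_add_mul
    have := mul_pos hy hA
    exact mul_nonneg (by linarith) (by linarith)
  have i2 : 0 ≤ A*((y-z)*(A-B)) :=
    mul_nonneg hA.le (mul_nonneg (by linarith) (by linarith))
  have key : 0 ≤ (E-F)*(E+F-D) := by
    rw [cmp]
    linarith
  linarith [nonneg_of_mul_nonneg_left key (by linarith)]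

end DualPair

/-- The system satisfied by the pairwise products `a₁ = VW`, `a₂ = UW`, `a₃ = UV` and `c₁ = EF`,
`c₂ = DF`, `c₃ = DE` of a dual pair. -/
structure ProductSystem (a₁ a₂ a₃ c₁ c₂ c₃ d₁ d₂ d₃ b m : ℝ) : Prop where
  hd₁ : 0 < d₁
  hd₂ : 0 < d₂
  hd₃ : 0 < d₃
  hb : 0 < b
  hm : 0 < m
  ha₁ : m < a₁
  ha₂ : m < a₂
  ha₃ : m < a₃
  hc₁ : m < c₁
  hc₂ : m < c₂
  hc₃ : m < c₃
  p₁ : c₁*a₂*a₃ = b + d₁*(a₂ + a₃ - m)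
  p₂ : c₂*a₁*a₃ = b + d₂*(a₁ + a₃ - m)
  p₃ : c₃*a₁*a₂ = b + d₃*(a₁ + a₂ - m)
  q₁ : a₁*c₂*c₃ = b + d₁*(c₂ + c₃ - m)
  q₂ : a₂*c₁*c₃ = b + d₂*(c₁ + c₃ - m)
  q₃ : a₃*c₁*c₂ = b + d₃*(c₁ + c₂ - m)

namespace ProductSystem

variable {a₁ a₂ a₃ c₁ c₂ c₃ d₁ d₂ d₃ b m : ℝ}

theorem symm (h : ProductSystem a₁ a₂ a₃ c₁ c₂ c₃ d₁ d₂ d₃ b m) :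
    ProductSystem c₁ c₂ c₃ a₁ a₂ a₃ d₁ d₂ d₃ b m := by
  obtain ⟨h1, h2, h3, h4, h5, h6, h7, h8, h9, h10, h11, p1, p2, p3, q1, q2, q3⟩ := h
  constructor <;> assumption

theorem swap12 (h : ProductSystem a₁ a₂ a₃ c₁ c₂ c₃ d₁ d₂ d₃ b m) :
    ProductSystem a₂ a₁ a₃ c₂ c₁ c₃ d₂ d₁ d₃ b m := by
  obtain ⟨h1, h2, h3, h4, h5, h6, h7, h8, h9, h10, h11, p1, p2, p3, q1, q2, q3⟩ := h
  constructor <;> first | assumption | linarith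

theorem swap23 (h : ProductSystem a₁ a₂ a₃ c₁ c₂ c₃ d₁ d₂ d₃ b m) :
    ProductSystem a₁ a₃ a₂ c₁ c₃ c₂ d₁ d₃ d₂ b m := by
  obtain ⟨h1, h2, h3, h4, h5, h6, h7, h8, h9, h10, h11, p1, p2, p3, q1, q2, q3⟩ := h
  constructor <;> first | assumption | linarith

theorem coupling_pos (h : ProductSystem a₁ a₂ a₃ c₁ c₂ c₃ d₁ d₂ d₃ b m) :
    0 < a₂*c₃ + a₃*c₂ - d₂ - d₃ := by
  have e : a₁ * (a₂*c₃ + a₃*c₂ - d₂ - d₃) = d₂*(a₃ - m) + d₃*(a₂ - m) + 2*b := by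
    linear_combination h.p₂ + h.p₃
  refine (mul_pos_iff_of_pos_left (h.hm.trans h.ha₁)).1 ?_
  rw [e]
  have := mul_pos h.hd₂ (sub_pos.2 h.ha₃)
  have := mul_pos h.hd₃ (sub_pos.2 h.ha₂)
  linarith [h.hb]

theorem coupling (h : ProductSystem a₁ a₂ a₃ c₁ c₂ c₃ d₁ d₂ d₃ b m) :
    (a₁ - c₁) * (a₂*c₃ + a₃*c₂ - d₂ - d₃) = d₂*(a₃ - c₃) + d₃*(a₂ - c₂) := by
  linear_combination h.p₂ + h.p₃ - h.q₂ - h.q₃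

theorem lt_of_lt (h : ProductSystem a₁ a₂ a₃ c₁ c₂ c₃ d₁ d₂ d₃ b m) (h1 : c₁ < a₁) :
    c₂ < a₂ := by
  by_contra! hle
  have e1 := h.coupling
  have e2 := h.swap12.coupling
  have i1 := mul_pos (sub_pos.2 h1) h.coupling_pos
  have i2 := mul_nonneg h.hd₃.le (sub_nonneg.2 hle)
  have i3 : 0 < d₂*(a₃ - c₃) := by linarith
  have i4 := mul_pos h.hd₁ ((mul_pos_iff_of_pos_left h.hd₂).1 i3)
  have i5 := mul_pos h.hd₃ (sub_pos.2 h1)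
  have i6 := mul_nonneg (sub_nonneg.2 hle) h.swap12.coupling_pos.le
  linarith

theorem all_lt (h : ProductSystem a₁ a₂ a₃ c₁ c₂ c₃ d₁ d₂ d₃ b m) (h1 : c₁ < a₁) :
    c₁ < a₁ ∧ c₂ < a₂ ∧ c₃ < a₃ :=
  ⟨h1, h.lt_of_lt h1, h.swap23.lt_of_lt h1⟩

theorem trichotomy (h : ProductSystem a₁ a₂ a₃ c₁ c₂ c₃ d₁ d₂ d₃ b m) :
    (c₁ < a₁ ∧ c₂ < a₂ ∧ c₃ < a₃) ∨ (a₁ < c₁ ∧ a₂ < c₂ ∧ a₃ < c₃) ∨ (a₁ = c₁ ∧ a₃ = c₃) := by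
  rcases lt_trichotomy a₁ c₁ with h1 | h1 | h1
  · exact Or.inr (Or.inl (h.symm.all_lt h1))
  · refine Or.inr (Or.inr ⟨h1, ?_⟩)
    rcases lt_trichotomy a₃ c₃ with h3 | h3 | h3
    · exact absurd h1 (h.symm.swap23.swap12.lt_of_lt h3).ne
    · exact h3
    · exact absurd h1 (h.swap23.swap12.lt_of_lt h3).ne'
  · exact Or.inl (h.all_lt h1)

theorem ratio (h : ProductSystem a₁ a₂ a₃ c₁ c₂ c₃ d₁ d₂ d₃ b m) :
    d₂*(c₁*a₃ - a₁*c₃) + d₃*(c₁*a₂ - a₁*c₂) = (a₁ - c₁)*(2*b - m*(d₂ + d₃)) := by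
  linear_combination a₁*(h.q₂ + h.q₃) - c₁*(h.p₂ + h.p₃)

theorem false_of_ratio_one_lt (h : ProductSystem a₁ a₂ a₃ c₁ c₂ c₃ d₁ d₂ d₃ b m)
    (h1 : c₁ < a₁) (o13 : 0 < c₁*a₃ - a₁*c₃) (o12 : 0 < c₁*a₂ - a₁*c₂) (hd : d₁ < d₃) :
    False := by
  obtain ⟨-, h2, h3⟩ := h.all_lt h1
  have k1 := h.ratio
  have k3 := h.swap23.swap12.ratio
  have hd₁ := h.hd₁
  have hd₂ := h.hd₂
  have hd₃ := h.hd₃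
  have s1 := sub_pos.2 h1
  have s2 := sub_pos.2 h2
  have s3 := sub_pos.2 h3
  have big : 0 < 2*b - m*(d₂ + d₃) := by
    refine (mul_pos_iff_of_pos_left s1).1 ?_
    rw [← k1]
    positivity
  have hlow : 0 < 2*b - m*d₂ := by
    linarith [mul_pos h.hm hd₃]
  have lhs : 0 < d₂*(c₁*a₃ - a₁*c₃)*((a₃-c₃)*d₁ + (a₁-c₁)*d₃)
      + d₁*d₃*((a₂-c₂)*(c₁*a₃ - a₁*c₃)) := by positivity
  have rhs : 0 < (a₁-c₁)*(a₃-c₃)*((d₃-d₁)*(2*b - m*d₂)) :=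
    mul_pos (mul_pos s1 s3) (mul_pos (sub_pos.2 hd) hlow)
  have e : d₂*(c₁*a₃ - a₁*c₃)*((a₃-c₃)*d₁ + (a₁-c₁)*d₃)
      + d₁*d₃*((a₂-c₂)*(c₁*a₃ - a₁*c₃)) = -((a₁-c₁)*(a₃-c₃)*((d₃-d₁)*(2*b - m*d₂))) := by
    linear_combination (a₃-c₃)*d₁*k1 - (a₁-c₁)*d₃*k3
  linarith

theorem lt_of_ratio_lt (h : ProductSystem a₁ a₂ a₃ c₁ c₂ c₃ d₁ d₂ d₃ b m)
    (h1 : c₁ < a₁) (o13 : 0 < c₁*a₃ - a₁*c₃) (o21 : 0 < c₂*a₁ - a₂*c₁)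
    (o23 : 0 < c₂*a₃ - a₂*c₃) : c₃ < c₂ := by
  obtain ⟨-, h2, h3⟩ := h.all_lt h1
  have k2 := h.swap12.ratio
  have k3 := h.swap23.swap12.ratio
  have hd₁ := h.hd₁
  have hd₂ := h.hd₂
  have hd₃ := h.hd₃
  have s2 := sub_pos.2 h2
  have s3 := sub_pos.2 h3
  have big : 0 < 2*b - m*(d₁ + d₃) := by
    refine (mul_pos_iff_of_pos_left s2).1 ?_
    rw [← k2]
    positivity
  have small : 0 < m*(d₁ + d₂) - 2*b := by
    refine (mul_pos_iff_of_pos_left s3).1 ?_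
    have : 0 < d₁*(c₂*a₃ - a₂*c₃) + d₂*(c₁*a₃ - a₁*c₃) := by positivity
    linarith
  have hd : d₃ < d₂ := by
    refine lt_of_mul_lt_mul_left (a := m) ?_ h.hm.le
    linarith
  by_contra! hle
  have hc₁ := h.hm.trans h.hc₁
  have i1 : 0 < c₁*(c₂*a₃ - a₂*c₃) := by positivity
  have i2 : 0 < (d₂ - d₃)*(c₁ + c₂ - m) :=
    mul_pos (sub_pos.2 hd) (by linarith [h.hc₂])
  have i3 : 0 ≤ d₂*(c₃ - c₂) := mul_nonneg hd₂.le (sub_nonneg.2 hle)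
  linarith [h.q₂, h.q₃]

end ProductSystem

namespace DualPair

variable {A B C D E F P Q R U V W x y z t m : ℝ}

theorem productSystem (h : DualPair A B C D E F P Q R U V W x y z t m)
    (hl : ¬ (A = B ∧ B = C)) (hr : ¬ (P = Q ∧ Q = R)) :
    ProductSystem (V*W) (U*W) (U*V) (E*F) (D*F) (D*E) (B*C*E*F) (A*C*D*F) (A*B*D*E)
      (A*B*C*D*E*F*t) m := by
  obtain ⟨hA, hB, hC, hD, hE, hF, hx, hy, hz, ht, -⟩ := id h.left
  obtain ⟨c1, c2, c3⟩ := h.left.m_lt hl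
  obtain ⟨a1, a2, a3⟩ := h.right.m_lt hr
  refine ⟨by positivity, by positivity, by positivity, by positivity, h.left.m_pos,
    a1, a2, a3, c1, c2, c3, ?_, ?_, ?_, ?_, ?_, ?_⟩
  · rw [h.UW, h.UV]
    linear_combination -B*C*E*F*h.left.eqA
  · rw [h.VW, h.UV]
    linear_combination -A*C*D*F*h.left.eqB
  · rw [h.VW, h.UW]
    linear_combination -A*B*D*E*h.left.eqC
  · rw [h.VW]
    linear_combination -B*C*E*F*h.left.eqD
  · rw [h.UW]
    linear_combination -A*C*D*F*h.left.eqE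
  · rw [h.UV]
    linear_combination -A*B*D*E*h.left.eqF

/-- The orders `C ≤ B ≤ A` and `Q ≤ R ≤ P` cannot both hold when `EF < VW`. -/
theorem false_of_maxes_agree_of_lt (h : DualPair A B C D E F P Q R U V W x y z t m)
    (hBA : B ≤ A) (hCB : C ≤ B) (hCA : C < A) (hRP : R ≤ P) (hQR : Q ≤ R) (hQP : Q < P)
    (hlt : E*F < V*W) : False := by
  obtain ⟨hA, hB, hC, hD, hE, hF, hx, hy, hz, ht, -⟩ := id h.left
  obtain ⟨-, -, -, hU, hV, hW, -⟩ := id h.right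
  obtain ⟨-, -, hDW, -⟩ := h.extremes hBA hCB hCA
  obtain ⟨-, -, hUE, -⟩ := h.symm.swap23.extremes hRP hQR hQP
  have hWE : W*E < F*V := by
    refine lt_of_mul_lt_mul_left (a := D*U) ?_ (by positivity)
    linarith [mul_lt_mul_of_pos_left hDW (mul_pos hU hE),
      mul_lt_mul_of_pos_left hUE (mul_pos hU hF)]
  have s := h.productSystem (fun e => hCA.ne' (e.1.trans e.2)) (fun e => hQP.ne' e.1)
  have hEF : E < F := by
    refine lt_of_mul_lt_mul_left (a := D) (s.lt_of_ratio_lt hlt ?_ ?_ ?_) hD.le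
    · linarith [mul_pos (mul_pos hE hV) (sub_pos.2 hDW)]
    · linarith [mul_pos (mul_pos hF hW) (sub_pos.2 hUE)]
    · linarith [mul_pos (mul_pos hD hU) (sub_pos.2 hWE)]
  have hyz : y < z := by
    by_contra! hzy
    exact hEF.not_ge (h.le_of_le hBA hCB hzy)
  have hsum := h.swap12.lt_iff_weight.1 hyz
  have hWV : W < V := by
    refine lt_of_mul_lt_mul_left (a := U) ?_ hU.le
    linarith [mul_lt_mul_of_pos_left hEF hD]
  exact hWV.not_ge (h.symm.swap23.le_of_le hRP hQR hyz.le)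

theorem false_of_maxes_agree (h : DualPair A B C D E F P Q R U V W x y z t m)
    (hBA : B ≤ A) (hCB : C ≤ B) (hCA : C < A) (hRP : R ≤ P) (hQR : Q ≤ R) (hQP : Q < P) :
    False := by
  obtain ⟨-, -, hDW, -⟩ := h.extremes hBA hCB hCA
  have s := h.productSystem (fun e => hCA.ne' (e.1.trans e.2)) (fun e => hQP.ne' e.1)
  rcases s.trichotomy with ⟨h1, -⟩ | ⟨h1, -⟩ | ⟨h1, h3⟩
  · exact h.false_of_maxes_agree_of_lt hBA hCB hCA hRP hQR hQP h1
  · exact h.symm.swap23.false_of_maxes_agree_of_lt hRP hQR hQP hBA hCB hCA (by linarith)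
  · have i := mul_pos (mul_pos h.left.hE h.right.hE) (sub_pos.2 hDW)
    have : (E*V)*(U*F - D*W) = 0 := by linear_combination -(D*E)*h1 + E*F*h3
    linarith

/-- The orders `C ≤ B ≤ A` and `R ≤ P ≤ Q` cannot both hold when `EF < VW`. -/
theorem false_of_mins_agree_of_lt (h : DualPair A B C D E F P Q R U V W x y z t m)
    (hBA : B ≤ A) (hCB : C ≤ B) (hCA : C < A) (hPQ : P ≤ Q) (hRP : R ≤ P) (hRQ : R < Q)
    (hlt : E*F < V*W) : False := by
  obtain ⟨hA, hB, hC, hD, hE, hF, hx, hy, hz, ht, -⟩ := id h.left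
  obtain ⟨-, -, -, hU, hV, hW, -⟩ := id h.right
  obtain ⟨hFD, -, hDW, -⟩ := h.extremes hBA hCB hCA
  obtain ⟨-, -, hVF, -⟩ := h.symm.swap12.extremes hPQ hRP hRQ
  have hVD : V*D < E*U := by
    refine lt_of_mul_lt_mul_left (a := W*F) ?_ (by positivity)
    linarith [mul_lt_mul_of_pos_left hDW (mul_pos hV hF),
      mul_lt_mul_of_pos_left hVF (mul_pos hU hF)]
  have s := h.productSystem (fun e => hCA.ne' (e.1.trans e.2)) (fun e => hRQ.ne' e.2)
  refine s.false_of_ratio_one_lt hlt ?_ ?_ ?_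
  · linarith [mul_pos (mul_pos hE hV) (sub_pos.2 hDW)]
  · linarith [mul_pos (mul_pos hF hW) (sub_pos.2 hVD)]
  · have : C*F < A*D := mul_lt_mul hCA hFD.le hF hA.le
    linarith [mul_lt_mul_of_pos_left this (mul_pos hB hE)]

theorem false_of_mins_agree (h : DualPair A B C D E F P Q R U V W x y z t m)
    (hBA : B ≤ A) (hCB : C ≤ B) (hCA : C < A) (hPQ : P ≤ Q) (hRP : R ≤ P) (hRQ : R < Q) :
    False := by
  obtain ⟨-, -, hDW, -⟩ := h.extremes hBA hCB hCA
  have s := h.productSystem (fun e => hCA.ne' (e.1.trans e.2)) (fun e => hRQ.ne' e.2)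
  rcases s.trichotomy with ⟨h1, -⟩ | ⟨-, h2, -⟩ | ⟨h1, h3⟩
  · exact h.false_of_mins_agree_of_lt hBA hCB hCA hPQ hRP hRQ h1
  · exact h.symm.swap12.false_of_mins_agree_of_lt hPQ hRP hRQ hBA hCB hCA h2
  · have i := mul_pos (mul_pos h.left.hE h.right.hE) (sub_pos.2 hDW)
    have : (E*V)*(U*F - D*W) = 0 := by linear_combination -(D*E)*h1 + E*F*h3
    linarith

theorem right_eq_of_sorted (h : DualPair A B C D E F P Q R U V W x y z t m)
    (hBA : B ≤ A) (hCB : C ≤ B) (hCA : C < A) : P = Q ∧ Q = R := by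
  obtain ⟨hFD, hWU, hDW, hxz⟩ := h.extremes hBA hCB hCA
  by_contra hne
  rcases le_total P Q with h1 | h1 <;> rcases le_total Q R with h2 | h2 <;>
    rcases le_total P R with h3 | h3
  · have hlt : P < R := lt_of_le_of_ne h3 (by grind)
    exact hxz.not_gt (h.symm.swap12.swap23.swap12.extremes h2 h1 hlt).2.2.2
  · exact hne (by grind)
  · exact hWU.not_ge (h.symm.swap12.swap23.le_of_le h2 h3 hxz.le)
  · have hlt : R < Q := lt_of_le_of_ne h2 (by grind)
    exact h.false_of_mins_agree hBA hCB hCA h1 h3 hlt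
  · have hlt : Q < R := lt_of_le_of_ne h2 (by grind)
    obtain ⟨-, hEF, -, hzy⟩ := h.symm.swap23.swap12.extremes h3 h1 hlt
    exact hEF.not_ge (h.le_of_le hBA hCB hzy.le)
  · have hlt : Q < P := lt_of_le_of_ne h1 (by grind)
    exact h.false_of_maxes_agree hBA hCB hCA h3 h2 hlt
  · exact hne (by grind)
  · have hlt : R < P := lt_of_le_of_ne h3 (by grind)
    have := (h.symm.extremes h1 h2 hlt).2.2.1
    linarith

/-- In a dual pair one of the two solutions has its first three unknowns equal. -/
theorem left_eq_or_right_eq (h : DualPair A B C D E F P Q R U V W x y z t m) :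
    (A = B ∧ B = C) ∨ (P = Q ∧ Q = R) := by
  by_cases hne : A = B ∧ B = C
  · exact Or.inl hne
  right
  rcases le_total A B with h1 | h1 <;> rcases le_total B C with h2 | h2 <;>
    rcases le_total A C with h3 | h3
  · have := h.swap12.swap23.swap12.right_eq_of_sorted h2 h1 (lt_of_le_of_ne h3 (by grind))
    grind
  · grind
  · have := h.swap12.swap23.right_eq_of_sorted h2 h3 (lt_of_le_of_ne h1 (by grind))
    grind
  · have := h.swap12.right_eq_of_sorted h1 h3 (lt_of_le_of_ne h2 (by grind))
    grind
  · have := h.swap23.swap12.right_eq_of_sorted h3 h1 (lt_of_le_of_ne h2 (by grind))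
    grind
  · have := h.swap23.right_eq_of_sorted h3 h2 (lt_of_le_of_ne h1 (by grind))
    grind
  · grind
  · exact h.right_eq_of_sorted h1 h2 (lt_of_le_of_ne h3 (by grind))

end DualPair

/-- A positive level set of `D(E+F-D)` and its cyclic images contains only diagonal points. -/
theorem eq_of_cyclic_eq {D E F k : ℝ} (hk : 0 < k) (h1 : D*(E+F-D) = k) (h2 : E*(D+F-E) = k)
    (h3 : F*(D+E-F) = k) : D = E ∧ E = F := by
  have d12 : (D-E)*(F-D-E) = 0 := by linear_combination h1 - h2
  have d23 : (E-F)*(D-E-F) = 0 := by linear_combination h2 - h3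
  have n12 : F-D-E ≠ 0 := fun h0 => hk.ne' (by linear_combination -h3 - F*h0)
  have n23 : D-E-F ≠ 0 := fun h0 => hk.ne' (by linear_combination -h1 - D*h0)
  exact ⟨sub_eq_zero.1 ((mul_eq_zero.1 d12).resolve_right n12),
    sub_eq_zero.1 ((mul_eq_zero.1 d23).resolve_right n23)⟩

theorem ReducedSol.m_eq_of_eq {a D E F x y z t m : ℝ} (h : ReducedSol a a a D E F x y z t m)
    (vol : a*a*a*D*E*F = 1) : m = 1 ∨ m = 5/(3*√3) := by
  obtain ⟨ha, -, -, hD, hE, hF, hx, hy, hz, ht, sq, eA, eB, eC, eD, eE, eF, eX, eY, eZ⟩ := id h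
  obtain ⟨j, hj⟩ : ∃ j, j = m - a^2 := ⟨_, rfl⟩
  have g1 : a*D*t - a^2*(y*z) = j := by linear_combination eA - hj
  have g2 : a*E*t - a^2*(x*z) = j := by linear_combination eB - hj
  have g3 : a*F*t - a^2*(x*y) = j := by linear_combination eC - hj
  have j_nonneg : 0 ≤ j := by
    have := mul_nonneg ha.le (sub_nonneg.2 h.gap_nonneg)
    linarith
  have hk : 0 < a^2 + 3*j := by positivity
  obtain ⟨rfl, rfl⟩ : D = E ∧ E = F := by
    refine eq_of_cyclic_eq hk ?_ ?_ ?_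
    · linear_combination eD + eX + g2 + g3 - hj
    · linear_combination eE + eY + g1 + g3 - hj
    · linear_combination eF + eZ + g1 + g2 - hj
  have hyz : y = x := by
    refine mul_right_cancel₀ (b := a^2*z) (by positivity) ?_
    linear_combination g2 - g1
  have hzx : z = x := by
    refine mul_right_cancel₀ (b := a^2*x) (by positivity) ?_
    subst hyz
    linear_combination g3 - g2
  subst hyz hzx
  have hDx : D^2*z = 3*j + a^2*z^2 := by
    linear_combination eX + 3*g1
  have hD2 : D^2 = a^2 + 3*j := by
    linear_combination eD - g1 + hDx - hj
  have haD : a*D = 1 := by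
    have : (a*D)^3 = 1 := by linear_combination vol
    exact (pow_eq_one_iff_of_nonneg (by positivity) (by norm_num)).1 this
  have dich : (1-z)*(a^2*z - 3*j) = 0 := by linear_combination hDx - z*hD2
  rcases mul_eq_zero.1 dich with hz1 | hjz
  · left
    obtain rfl : z = 1 := by linarith
    have ht1 : t = 1 := (pow_eq_one_iff_of_nonneg ht.le two_ne_zero).1 (by linear_combination sq)
    subst ht1
    linear_combination haD - g1 - hj
  · right
    have hpoly : a^4*z^2*(1 - 3*z) = 0 := by
      have e1 : (a*D*t)^2 = (j + a^2*z^2)^2 := by rw [← g1]; ring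
      have e2 : (a*D*t)^2 = a^2*(a^2+3*j)*z^3 := by
        rw [← hD2]; linear_combination (a*D)^2*sq
      have hj3 : j = a^2*z/3 := by linarith
      rw [e1, hj3] at e2
      linear_combination 9*e2
    have hz3 : z = 1/3 := by
      have := (mul_eq_zero.1 hpoly).resolve_left (by positivity)
      linarith
    have hm : m = 10/9*a^2 := by rw [hz3] at hjz; linarith
    have ha4 : a^4 = 3/4 := by
      have : D^2 = 4/3*a^2 := by rw [hz3] at hjz; linarith
      have e : a^2*D^2 = 1 := by linear_combination (a*D+1)*haD
      rw [this] at e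
      linarith
    have h3 : √3^2 = (3:ℝ) := Real.sq_sqrt (by norm_num)
    rw [eq_div_iff (by positivity)]
    refine (pow_left_inj₀ (n := 2) ?_ (by norm_num) two_ne_zero).1 ?_
    · rw [hm]; positivity
    · rw [hm]
      linear_combination (100/9*a^4)*h3 + 100/3*ha4

theorem ReducedSol.m_eq {A B C D E F x y z t m : ℝ} (h : ReducedSol A B C D E F x y z t m)
    (vol : A*B*C*D*E*F = 1) : m = 1 ∨ m = 5/(3*√3) := by
  obtain ⟨P, Q, R, U, V, W, hd⟩ := h.exists_dualPair
  rcases hd.left_eq_or_right_eq with ⟨rfl, rfl⟩ | ⟨rfl, rfl⟩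
  · exact h.m_eq_of_eq vol
  · refine hd.right.m_eq_of_eq ?_
    rw [← vol]
    linear_combination P*P*V*W*hd.PU + A*D*P*W*hd.QV + A*D*B*E*hd.RW

/-- Every solution of (S1) with positive `A,…,F` has `μ = -1` or `μ = -5/(3√3)`;
equivalently, the scalar curvature `S = -3μ` equals `3` or `5/√3`. -/
theorem systemS1_mu_values (A B C D E F X Y Z μ : ℝ)
    (hA : 0 < A) (hB : 0 < B) (hC : 0 < C)
    (hD : 0 < D) (hE : 0 < E) (hF : 0 < F)
    (hsol : SystemS1 A B C D E F X Y Z μ) :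
    μ = -1 ∨ μ = -5/(3*Real.sqrt 3) := by
  obtain ⟨vol, e2, e3, e4, e5, e6, e7, e8, e9, e10⟩ := hsol
  have eX : X^2*((B-C)^2 + B^2*Z^2 + C^2*Y^2 + D^2) = (A*D + B*E + C*F)*(X*Y*Z) := by
    linear_combination -X*e8
  have eY : Y^2*((A-C)^2 + A^2*Z^2 + C^2*X^2 + E^2) = (A*D + B*E + C*F)*(X*Y*Z) := by
    linear_combination -Y*e9
  have eZ : Z^2*((A-B)^2 + A^2*Y^2 + B^2*X^2 + F^2) = (A*D + B*E + C*F)*(X*Y*Z) := by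
    linear_combination -Z*e10
  by_cases ht : X*Y*Z = 0
  · left
    rw [ht, mul_zero] at eX eY eZ
    have hX : X = 0 := by
      simpa using (mul_eq_zero.1 eX).resolve_right (by positivity)
    have hY : Y = 0 := by
      simpa using (mul_eq_zero.1 eY).resolve_right (by positivity)
    have hZ : Z = 0 := by
      simpa using (mul_eq_zero.1 eZ).resolve_right (by positivity)
    subst hX hY hZ
    have f1 : A*(B+C-A) = -μ := by linear_combination A*e2 - μ*vol
    have f2 : B*(A+C-B) = -μ := by linear_combination B*e3 - μ*vol
    have f3 : C*(A+B-C) = -μ := by linear_combination C*e4 - μ*vol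
    have f4 : D*(E+F-D) = -μ := by linear_combination D*e5 - μ*vol
    have f5 : E*(D+F-E) = -μ := by linear_combination E*e6 - μ*vol
    have f6 : F*(D+E-F) = -μ := by linear_combination F*e7 - μ*vol
    have hμ : 0 < -μ := by
      by_contra! hle
      have i1 := nonpos_of_mul_nonpos_right (f1 ▸ hle) hA
      have i2 := nonpos_of_mul_nonpos_right (f2 ▸ hle) hB
      linarith
    obtain ⟨rfl, rfl⟩ := eq_of_cyclic_eq hμ f1 f2 f3
    obtain ⟨rfl, rfl⟩ := eq_of_cyclic_eq hμ f4 f5 f6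
    have hcube : (-μ)^3 = 1 := by
      have hAD : A = D := (pow_left_inj₀ hA.le hD.le two_ne_zero).1 (by linear_combination f1 - f4)
      subst hAD
      rw [← f1]
      linear_combination vol
    have := (pow_eq_one_iff_of_nonneg hμ.le (by norm_num)).1 hcube
    linarith
  · have hX : X ≠ 0 := by rintro rfl; simp at ht
    have hY : Y ≠ 0 := by rintro rfl; simp at ht
    have hZ : Z ≠ 0 := by rintro rfl; simp at ht
    have hS : 0 < A*D + B*E + C*F := by positivity
    have htpos : 0 < X*Y*Z := by
      refine (mul_pos_iff_of_pos_left hS).1 ?_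
      rw [← eX]
      positivity
    have h : ReducedSol A B C D E F (X^2) (Y^2) (Z^2) (X*Y*Z) (-μ) := by
      refine ⟨hA, hB, hC, hD, hE, hF, by positivity, by positivity, by positivity, htpos, by ring,
        ?_, ?_, ?_, ?_, ?_, ?_, eX, eY, eZ⟩
      · linear_combination A*e2 - μ*vol
      · linear_combination B*e3 - μ*vol
      · linear_combination C*e4 - μ*vol
      · linear_combination D*e5 - μ*vol
      · linear_combination E*e6 - μ*vol
      · linear_combination F*e7 - μ*vol
    rcases h.m_eq (by linarith) with hm | hm
    · left
      linarith
    · right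
      rw [neg_div]
      linarith
end

section
/- The set of real solutions (A,B,C,D,E,F,X,Y,Z,W,𝒞,μ) of the system (S2) with A,B,C,D,E,F > 0 is infinite; in particular, (S2) admits continuous (one-parameter) families of real solutions. -/
/-- The system (S2) of 12 polynomial equations arising from left-invariant Einstein
metrics on S³×S³ invariant under a ℤ₂ subgroup of inner automorphisms.
Here `G` denotes the variable `𝒞`. -/
def SystemS2 (A B C D E F X Y Z W G μ : ℝ) : Prop :=
  A*B*C*D*E*F - 1 = 0 ∧
  -D + E + F + A*B*C*E*F*μ - D*X^2 + A*X*Y*Z - A*W*X*G = 0 ∧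
  D - E + F + A*B*C*D*F*μ - E*W^2 - E*Y^2 + B*X*Y*Z - C*W*X*G = 0 ∧
  A - B + C + A*C*D*E*F*μ + A*W^2 - B*W^2 - B*X^2 + C*X^2 - B*W^2*X^2 + E*X*Y*Z
    + A*Z^2 - B*Z^2 - B*X^2*Z^2 - F*W*X*G = 0 ∧
  D + E - F + A*B*C*D*E*μ + C*X*Y*Z - F*Z^2 - B*W*X*G - F*G^2 = 0 ∧
  -A + B + C + B*C*D*E*F*μ - A*W^2 + B*W^2 - A*Y^2 + C*Y^2 + D*X*Y*Z - A*Z^2 + B*Z^2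
    - A*Y^2*Z^2 - D*W*X*G + 2*A*W*Y*Z*G - A*G^2 + C*G^2 - A*W^2*G^2 = 0 ∧
  A + B - C + A*B*D*E*F*μ + B*X^2 - C*X^2 + A*Y^2 - C*Y^2 - C*X^2*Y^2 + F*X*Y*Z
    - E*W*X*G + A*G^2 - C*G^2 - C*X^2*G^2 = 0 ∧
  -(A*D*W*X) - C*E*W*X - B*F*W*X + A^2*W*Y*Z - A^2*G + 2*A*C*G - C^2*G - F^2*G
    - A^2*W^2*G - C^2*X^2*G = 0 ∧
  A*D*X*Y + B*E*X*Y + C*F*X*Y - A^2*Z + 2*A*B*Z - B^2*Z - F^2*Z - B^2*X^2*Z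
    - A^2*Y^2*Z + A^2*W*Y*G = 0 ∧
  -(A^2*Y) + 2*A*C*Y - C^2*Y - E^2*Y - C^2*X^2*Y + A*D*X*Z + B*E*X*Z + C*F*X*Z
    - A^2*Y*Z^2 + A^2*W*Z*G = 0 ∧
  -(A^2*W) + 2*A*B*W - B^2*W - E^2*W - B^2*W*X^2 - A*D*X*G - C*E*X*G - B*F*X*G
    + A^2*Y*Z*G - A^2*W*G^2 = 0 ∧
  -(B^2*X) + 2*B*C*X - C^2*X - D^2*X - B^2*W^2*X - C^2*X*Y^2 + A*D*Y*Z + B*E*Y*Z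
    + C*F*Y*Z - B^2*X*Z^2 - A*D*W*G - C*E*W*G - B*F*W*G - C^2*X*G^2 = 0

/-- Points `(c, s)` of the unit circle give solutions of (S2): the rotations of one factor
applied to the solution with `A = ⋯ = F = X = Y = Z = 1`, `W = G = 0` and `μ = -1`. -/
theorem systemS2_of_unit_circle {c s : ℝ} (h : c ^ 2 + s ^ 2 = 1) :
    SystemS2 1 1 1 1 1 1 1 c c s (-s) (-1) := by
  refine ⟨by norm_num, ?_, ?_, ?_, ?_, ?_, ?_, ?_, ?_, ?_, ?_, ?_⟩
  · linear_combination h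
  · ring
  · ring
  · ring
  · linear_combination -(c ^ 2 + s ^ 2) * h
  · ring
  · linear_combination s * h
  · linear_combination -c * h
  · linear_combination -c * h
  · linear_combination -s * h
  · linear_combination h

/-- The set of real solutions of (S2) with positive `A,…,F` is infinite:
(S2) admits continuous families of real solutions. -/
theorem systemS2_infinitely_many_solutions :
    {v : Fin 12 → ℝ |
      0 < v 0 ∧ 0 < v 1 ∧ 0 < v 2 ∧ 0 < v 3 ∧ 0 < v 4 ∧ 0 < v 5 ∧
      SystemS2 (v 0) (v 1) (v 2) (v 3) (v 4) (v 5) (v 6) (v 7) (v 8) (v 9)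
        (v 10) (v 11)}.Infinite := by
  refine Set.infinite_of_injOn_mapsTo (s := Set.Icc (0 : ℝ) 1)
    (f := fun t => ![1, 1, 1, 1, 1, 1, 1, √(1 - t ^ 2), √(1 - t ^ 2), t, -t, -1])
    (fun t _ u _ htu => congrFun htu 9) ?_ (Set.Icc_infinite one_pos)
  rintro t ⟨ht0, ht1⟩
  have h : √(1 - t ^ 2) ^ 2 + t ^ 2 = 1 := by
    rw [Real.sq_sqrt (by nlinarith)]
    ring
  exact ⟨one_pos, one_pos, one_pos, one_pos, one_pos, one_pos, systemS2_of_unit_circle h⟩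
end

section
/- For every δ ∈ {1, 1/√2}, every X ∈ {−1, 1}, and every (Y,𝒞) ∈ ℝ² with Y² + 𝒞² = 1, the tuple (A,B,C,D,E,F,X,Y,Z,W,𝒞,μ) = (δ, δ, δ, δ⁻¹, δ⁻¹, δ⁻¹, X, Y, XY, −X𝒞, 𝒞, −1) is a solution of the system (S2). In particular, (S2) admits one-parameter families of real solutions with μ = −1. -/
/-- The one-parameter families of solutions of (S2) with `μ = -1`:
for `δ ∈ {1, 1/√2}`, `X ∈ {-1,1}` and `Y² + 𝒞² = 1`, the tuple
`(δ,δ,δ,δ⁻¹,δ⁻¹,δ⁻¹,X,Y,XY,-X𝒞,𝒞,-1)` solves (S2). -/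
theorem systemS2_mu_neg_one_families (δ X Y 𝒞 : ℝ)
    (hδ : δ = 1 ∨ δ = (Real.sqrt 2)⁻¹) (hX : X = -1 ∨ X = 1)
    (hY𝒞 : Y^2 + 𝒞^2 = 1) :
    SystemS2 δ δ δ δ⁻¹ δ⁻¹ δ⁻¹ X Y (X*Y) (-(X*𝒞)) 𝒞 (-1) := by
  have hX2 : X ^ 2 = 1 := by rcases hX with rfl | rfl <;> norm_num
  have hδ0 : δ ≠ 0 := by rcases hδ with rfl | rfl <;> positivity
  have hinv : δ * δ⁻¹ = 1 := mul_inv_cancel₀ hδ0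
  have hquad : δ⁻¹ ^ 2 + 2 * δ ^ 2 = 3 := by
    rcases hδ with rfl | rfl <;> norm_num
  generalize δ⁻¹ = ε at *
  clear hδ hX hδ0
  unfold SystemS2
  refine ⟨?_, ?_, ?_, ?_, ?_, ?_, ?_, ?_, ?_, ?_, ?_, ?_⟩ <;> grind
end

section
/- Let α = 3^{1/4}/√2 and β = √2/3^{1/4}. For every X ∈ {−1/√3, 1/√3} and every (Y,𝒞) ∈ ℝ² with Y² + 𝒞² = 1/3, the tuple (A,B,C,D,E,F,X,Y,Z,W,𝒞,μ) = (α, α, α, β, β, β, X, Y, √3·XY, −√3·X𝒞, 𝒞, −5/(3√3)) is a solution of the system (S2). In particular, (S2) admits one-parameter families of real solutions with μ = −5/(3√3). -/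
/-- The families solve (S2) for any `s`, `a` and `b` satisfying the polynomial relations of
`√3`, `3^{1/4}/√2` and `√2/3^{1/4}`. -/
theorem systemS2_of_relations {s a b X Y G : ℝ} (hs : s ^ 2 = 3) (ha : a ^ 2 = s / 2)
    (hb : b = 2 / 3 * s * a) (hX : X ^ 2 = 1 / 3) (hG : Y ^ 2 + G ^ 2 = 1 / 3) :
    SystemS2 a a a b b b X Y (s * X * Y) (-(s * X * G)) G (-5 / 9 * s) := by
  subst hb
  refine ⟨?_, ?_, ?_, ?_, ?_, ?_, ?_, ?_, ?_, ?_, ?_, ?_⟩ <;> grind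

/-- The one-parameter families of solutions of (S2) with `μ = -5/(3√3)`:
with `α = 3^{1/4}/√2`, `β = √2/3^{1/4}`, for `X ∈ {-1/√3, 1/√3}` and
`Y² + 𝒞² = 1/3`, the tuple `(α,α,α,β,β,β,X,Y,√3·XY,-√3·X𝒞,𝒞,-5/(3√3))`
solves (S2). -/
theorem systemS2_mu_nearlyKaehler_families (X Y 𝒞 : ℝ)
    (hX : X = -(Real.sqrt 3)⁻¹ ∨ X = (Real.sqrt 3)⁻¹)
    (hY𝒞 : Y^2 + 𝒞^2 = 1/3) :
    SystemS2 (Real.sqrt (Real.sqrt 3) / Real.sqrt 2)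
      (Real.sqrt (Real.sqrt 3) / Real.sqrt 2)
      (Real.sqrt (Real.sqrt 3) / Real.sqrt 2)
      (Real.sqrt 2 / Real.sqrt (Real.sqrt 3))
      (Real.sqrt 2 / Real.sqrt (Real.sqrt 3))
      (Real.sqrt 2 / Real.sqrt (Real.sqrt 3))
      X Y (Real.sqrt 3 * X * Y) (-(Real.sqrt 3 * X * 𝒞)) 𝒞
      (-5/(3*Real.sqrt 3)) := by
  have hs : Real.sqrt 3 ^ 2 = 3 := Real.sq_sqrt (by norm_num)
  have hr : Real.sqrt (Real.sqrt 3) ^ 2 = Real.sqrt 3 := Real.sq_sqrt (Real.sqrt_nonneg 3)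
  have ht : Real.sqrt 2 ^ 2 = 2 := Real.sq_sqrt (by norm_num)
  have hμ : -5 / (3 * Real.sqrt 3) = -5 / 9 * Real.sqrt 3 := by
    field_simp
    linarith
  rw [hμ]
  refine systemS2_of_relations hs (by rw [div_pow, hr, ht]) ?_ ?_ hY𝒞
  · field_simp
    rw [hr, ht]
    linear_combination -2 * hs
  · rcases hX with rfl | rfl <;> simp
end
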